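/- arXiv:1605.07896 — 12 statements merged into one kernel-verified Lean document; each statement's English description precedes it below -/
import Mathlib

section
/- Let G be a finite Bayesian game and (f,g,Q) a solution of G. Suppose that for every player i, every type t_i ∈ T_i, every input r_i ∈ R_i and every function χ_i : T_i × S_i → A_i, one has ∑_{t_{-i},λ,s} P(t) Λ(λ) Q(s | f_1(t_1,λ_1),…,f_n(t_n,λ_n)) · v_i(t, g_1(t_1,s_1,λ_1),…,g_n(t_n,s_n,λ_n)) ≥ ∑_{t_{-i},λ,s} P(t) Λ(λ) Q(s | (r_i, f_{-i}(t_{-i},λ_{-i}))) · v_i(t, (χ_i(t_i,s_i), g_{-i}(t_{-i},s_{-i},λ_{-i}))), where (r_i, f_{-i}(t_{-i},λ_{-i})) denotes the input profile whose i-th entry is r_i and whose j-th entry (j ≠ i) is f_j(t_j,λ_j), and (χ_i(t_i,s_i), g_{-i}(t_{-i},s_{-i},λ_{-i})) denotes the action profile whose i-th entry is χ_i(t_i,s_i) and whose j-th entry (j ≠ i) is g_j(t_j,s_j,λ_j). Then (f,g,Q) is a communication equilibrium of G. -/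
open Finset

/-- A correlation: nonnegative entries, and for each input profile the outputs
form a probability distribution. -/
def IsCorrelation {ι : Type} [Fintype ι] [DecidableEq ι] {R S : ι → Type}
    [∀ i, Fintype (S i)]
    (Q : (∀ i, R i) → (∀ i, S i) → ℝ) : Prop :=
  (∀ r s, 0 ≤ Q r s) ∧ ∀ r, ∑ s : ∀ i, S i, Q r s = 1

/-- Expected payoff of player `i` in the solution `(f, g, Q)` of the Bayesian game
with prior `P`, payoffs `v` and local randomness distributions `μ`. -/
noncomputable def expPayoff {ι : Type} [Fintype ι] [DecidableEq ι]
    {T A R S Λ : ι → Type}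
    [∀ i, Fintype (T i)] [∀ i, Fintype (S i)] [∀ i, Fintype (Λ i)]
    (P : (∀ i, T i) → ℝ) (v : ι → (∀ i, T i) → (∀ i, A i) → ℝ)
    (μ : ∀ i, Λ i → ℝ)
    (f : ∀ i, T i → Λ i → R i) (g : ∀ i, T i → S i → Λ i → A i)
    (Q : (∀ i, R i) → (∀ i, S i) → ℝ) (i : ι) : ℝ :=
  ∑ t : ∀ j, T j, ∑ lam : ∀ j, Λ j, ∑ s : ∀ j, S j,
    P t * (∏ j, μ j (lam j)) * Q (fun j => f j (t j) (lam j)) s *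
      v i t (fun j => g j (t j) (s j) (lam j))

/-- Expected payoff of player `i` when he unilaterally deviates to `(φ, χ)`. -/
noncomputable def devPayoff {ι : Type} [Fintype ι] [DecidableEq ι]
    {T A R S Λ : ι → Type}
    [∀ i, Fintype (T i)] [∀ i, Fintype (S i)] [∀ i, Fintype (Λ i)]
    (P : (∀ i, T i) → ℝ) (v : ι → (∀ i, T i) → (∀ i, A i) → ℝ)
    (μ : ∀ i, Λ i → ℝ)
    (f : ∀ i, T i → Λ i → R i) (g : ∀ i, T i → S i → Λ i → A i)
    (Q : (∀ i, R i) → (∀ i, S i) → ℝ) (i : ι)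
    (φ : T i → Λ i → R i) (χ : T i → S i → Λ i → A i) : ℝ :=
  ∑ t : ∀ j, T j, ∑ lam : ∀ j, Λ j, ∑ s : ∀ j, S j,
    P t * (∏ j, μ j (lam j)) *
      Q (Function.update (fun j => f j (t j) (lam j)) i (φ (t i) (lam i))) s *
      v i t (Function.update (fun j => g j (t j) (s j) (lam j)) i (χ (t i) (s i) (lam i)))

/-- `(f,g,Q)` is a communication equilibrium: no player can profit by a unilateral
deviation `(φ, χ)`. -/
def IsCommEq {ι : Type} [Fintype ι] [DecidableEq ι]
    {T A R S Λ : ι → Type}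
    [∀ i, Fintype (T i)] [∀ i, Fintype (S i)] [∀ i, Fintype (Λ i)]
    (P : (∀ i, T i) → ℝ) (v : ι → (∀ i, T i) → (∀ i, A i) → ℝ)
    (μ : ∀ i, Λ i → ℝ)
    (f : ∀ i, T i → Λ i → R i) (g : ∀ i, T i → S i → Λ i → A i)
    (Q : (∀ i, R i) → (∀ i, S i) → ℝ) : Prop :=
  ∀ (i : ι) (φ : T i → Λ i → R i) (χ : T i → S i → Λ i → A i),
    expPayoff P v μ f g Q i ≥ devPayoff P v μ f g Q i φ χ

/-- The product weight is symmetric under exchanging a coordinate with an independent copy. -/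
theorem prod_update_mul {ι : Type} [Fintype ι] [DecidableEq ι] {Λ : ι → Type}
    (μ : ∀ i, Λ i → ℝ) (i : ι) (l : Λ i) (lam : ∀ j, Λ j) :
    μ i (lam i) * ∏ j, μ j (Function.update lam i l j) = μ i l * ∏ j, μ j (lam j) := by
  rw [← Finset.mul_prod_erase univ _ (mem_univ i),
    ← Finset.mul_prod_erase univ (fun j => μ j (lam j)) (mem_univ i), Function.update_self]
  have h : ∏ j ∈ univ.erase i, μ j (Function.update lam i l j)
      = ∏ j ∈ univ.erase i, μ j (lam j) :=
    prod_congr rfl fun j hj => by rw [Function.update_of_ne (ne_of_mem_erase hj)]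
  rw [h]
  ring

/-- Under a product distribution, a coordinate may be averaged out separately. -/
theorem sum_prod_weight_eq_sum_sum {ι : Type} [Fintype ι] [DecidableEq ι] {Λ : ι → Type}
    [∀ i, Fintype (Λ i)] (μ : ∀ i, Λ i → ℝ) (i : ι) (hμ : ∑ l, μ i l = 1)
    (H : Λ i → (∀ j, Λ j) → ℝ) (hH : ∀ l l' lam, H l (Function.update lam i l') = H l lam) :
    ∑ lam : ∀ j, Λ j, (∏ j, μ j (lam j)) * H (lam i) lam
      = ∑ l, μ i l * ∑ lam : ∀ j, Λ j, (∏ j, μ j (lam j)) * H l lam := by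
  have swap_involutive : Function.Involutive
      (fun p : Λ i × (∀ j, Λ j) => (p.2 i, Function.update p.2 i p.1)) := fun p => by simp
  calc ∑ lam : ∀ j, Λ j, (∏ j, μ j (lam j)) * H (lam i) lam
      = ∑ l, μ i l * ∑ lam : ∀ j, Λ j, (∏ j, μ j (lam j)) * H (lam i) lam := by
        rw [← sum_mul, hμ, one_mul]
    _ = ∑ p : Λ i × (∀ j, Λ j), μ i p.1 * ((∏ j, μ j (p.2 j)) * H (p.2 i) p.2) := by
        simp_rw [Fintype.sum_prod_type, mul_sum]
    _ = ∑ p : Λ i × (∀ j, Λ j), μ i p.1 * ((∏ j, μ j (p.2 j)) * H p.1 p.2) := by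
        refine Fintype.sum_equiv swap_involutive.toPerm _ _ fun p => ?_
        simp only [Function.Involutive.coe_toPerm, hH]
        rw [← mul_assoc, ← mul_assoc, prod_update_mul]
    _ = ∑ l, μ i l * ∑ lam : ∀ j, Λ j, (∏ j, μ j (lam j)) * H l lam := by
        simp_rw [Fintype.sum_prod_type, mul_sum]

/-- Updating coordinate `i` after a pointwise map forgets an earlier update of the argument there. -/
theorem update_comp_update {ι : Type} [DecidableEq ι] {Λ B : ι → Type}
    (h : ∀ j, Λ j → B j) (lam : ∀ j, Λ j) (i : ι) (l : Λ i) (b : B i) :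
    Function.update (fun j => h j (Function.update lam i l j)) i b
      = Function.update (fun j => h j (lam j)) i b := by
  ext j
  rcases eq_or_ne j i with rfl | hj
  · simp
  · simp [hj]

/-- A deviation using local randomness is a mixture of deterministic deviations. -/
theorem devPayoff_eq_sum {ι : Type} [Fintype ι] [DecidableEq ι]
    {T A R S Λ : ι → Type}
    [∀ i, Fintype (T i)] [∀ i, Fintype (S i)] [∀ i, Fintype (Λ i)]
    (P : (∀ i, T i) → ℝ) (v : ι → (∀ i, T i) → (∀ i, A i) → ℝ)
    (μ : ∀ i, Λ i → ℝ)
    (f : ∀ i, T i → Λ i → R i) (g : ∀ i, T i → S i → Λ i → A i)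
    (Q : (∀ i, R i) → (∀ i, S i) → ℝ) (i : ι) (hμ : ∑ l, μ i l = 1)
    (φ : T i → Λ i → R i) (χ : T i → S i → Λ i → A i) :
    devPayoff P v μ f g Q i φ χ
      = ∑ l, μ i l * devPayoff P v μ f g Q i (fun t _ => φ t l) (fun t s _ => χ t s l) := by
  unfold devPayoff
  conv_rhs => enter [2, l]; rw [mul_sum]
  refine Eq.trans ?_ sum_comm
  refine sum_congr rfl fun t _ => ?_
  have hH (l l' : Λ i) (lam : ∀ j, Λ j) :
      (∑ s : ∀ j, S j, P t *
        Q (Function.update (fun j => f j (t j) (Function.update lam i l' j)) i (φ (t i) l)) s *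
        v i t (Function.update (fun j => g j (t j) (s j) (Function.update lam i l' j)) i
          (χ (t i) (s i) l)))
        = ∑ s : ∀ j, S j, P t *
          Q (Function.update (fun j => f j (t j) (lam j)) i (φ (t i) l)) s *
          v i t (Function.update (fun j => g j (t j) (s j) (lam j)) i (χ (t i) (s i) l)) :=
    sum_congr rfl fun s _ => by
      rw [update_comp_update (fun j => f j (t j)),
        update_comp_update (fun j => g j (t j) (s j))]
  have h := sum_prod_weight_eq_sum_sum μ i hμ
    (fun l lam => ∑ s : ∀ j, S j, P t *
      Q (Function.update (fun j => f j (t j) (lam j)) i (φ (t i) l)) s *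
      v i t (Function.update (fun j => g j (t j) (s j) (lam j)) i (χ (t i) (s i) l))) hH
  simp only [mul_sum] at h ⊢
  refine (Eq.trans ?_ h).trans ?_
  · exact sum_congr rfl fun lam _ => sum_congr rfl fun s _ => by ring
  · exact sum_congr rfl fun l _ => sum_congr rfl fun lam _ => sum_congr rfl fun s _ => by ring

/-- Splitting a sum over type profiles according to the type of player `i`. -/
theorem sum_sum_ite_type {ι : Type} [Fintype ι] [DecidableEq ι] {T S Λ : ι → Type}
    [∀ i, Fintype (T i)] [∀ i, DecidableEq (T i)] [∀ i, Fintype (S i)] [∀ i, Fintype (Λ i)]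
    (i : ι) (F : (∀ j, T j) → (∀ j, Λ j) → (∀ j, S j) → ℝ) :
    ∑ ti : T i, ∑ t, ∑ lam, ∑ s, (if t i = ti then F t lam s else 0)
      = ∑ t, ∑ lam, ∑ s, F t lam s := by
  rw [sum_comm]
  refine sum_congr rfl fun t _ => ?_
  rw [sum_comm]
  refine sum_congr rfl fun lam _ => ?_
  rw [sum_comm]
  refine sum_congr rfl fun s _ => ?_
  simp

/-- if for every player `i`, every type `ti`, every input `ri` and every
function `χ : T i → S i → A i` the displayed inequality (with the sum restricted to
type profiles whose `i`-th entry is `ti`) holds, then `(f,g,Q)` is a communication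
equilibrium. -/
theorem stmt0 {ι : Type} [Fintype ι] [DecidableEq ι]
    {T A R S Λ : ι → Type}
    [∀ i, Fintype (T i)] [∀ i, Nonempty (T i)] [∀ i, DecidableEq (T i)]
    [∀ i, Fintype (A i)] [∀ i, Nonempty (A i)]
    [∀ i, Fintype (S i)] [∀ i, Fintype (Λ i)] [∀ i, Nonempty (Λ i)]
    (P : (∀ i, T i) → ℝ) (v : ι → (∀ i, T i) → (∀ i, A i) → ℝ)
    (μ : ∀ i, Λ i → ℝ)
    (f : ∀ i, T i → Λ i → R i) (g : ∀ i, T i → S i → Λ i → A i)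
    (Q : (∀ i, R i) → (∀ i, S i) → ℝ)
    (hP0 : ∀ t, 0 ≤ P t) (hP1 : ∑ t : ∀ i, T i, P t = 1)
    (hμ0 : ∀ i l, 0 ≤ μ i l) (hμ1 : ∀ i, ∑ l : Λ i, μ i l = 1)
    (hQ : IsCorrelation Q)
    (hyp : ∀ (i : ι) (ti : T i) (ri : R i) (χ : T i → S i → A i),
      (∑ t : ∀ j, T j, ∑ lam : ∀ j, Λ j, ∑ s : ∀ j, S j,
        if t i = ti then
          P t * (∏ j, μ j (lam j)) * Q (fun j => f j (t j) (lam j)) s *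
            v i t (fun j => g j (t j) (s j) (lam j))
        else 0) ≥
      ∑ t : ∀ j, T j, ∑ lam : ∀ j, Λ j, ∑ s : ∀ j, S j,
        if t i = ti then
          P t * (∏ j, μ j (lam j)) *
            Q (Function.update (fun j => f j (t j) (lam j)) i ri) s *
            v i t (Function.update (fun j => g j (t j) (s j) (lam j)) i (χ (t i) (s i)))
        else 0) :
    IsCommEq P v μ f g Q := by
  intro i φ χ
  have deterministic_le : ∀ l : Λ i,
      devPayoff P v μ f g Q i (fun t _ => φ t l) (fun t s _ => χ t s l)
        ≤ expPayoff P v μ f g Q i := fun l => by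
    unfold devPayoff expPayoff
    rw [← sum_sum_ite_type i, ← sum_sum_ite_type i]
    refine sum_le_sum fun ti _ => ?_
    refine le_of_eq_of_le ?_ (hyp i ti (φ ti l) (fun t s => χ t s l))
    refine sum_congr rfl fun t _ => sum_congr rfl fun lam _ => sum_congr rfl fun s _ => ?_
    split_ifs with h
    · rw [h]
    · rfl
  rw [ge_iff_le, devPayoff_eq_sum P v μ f g Q i (hμ1 i)]
  calc ∑ l, μ i l * devPayoff P v μ f g Q i (fun t _ => φ t l) (fun t s _ => χ t s l)
      ≤ ∑ l, μ i l * expPayoff P v μ f g Q i :=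
        sum_le_sum fun l _ => mul_le_mul_of_nonneg_left (deterministic_le l) (hμ0 i l)
    _ = expPayoff P v μ f g Q i := by rw [← sum_mul, hμ1, one_mul]
end

section
/- Let G be a finite Bayesian game and (f,g,Q) a communication equilibrium of G. Then its canonical representative Q̂ is a correlation with inputs T and outputs A, Q̂ is a canonical communication equilibrium of G, and the expected payoffs coincide: for every player i, ∑_{t,a} P(t) Q̂(a|t) v_i(t,a) = ⟨v_i⟩. -/
open Finset

/-- A correlation is belief-invariant (non-signalling) if for every subset `I` of the
players the joint marginal distribution of the outputs of the players in `I` depends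
only on the inputs of the players in `I`. -/
def IsBeliefInvariant {ι : Type} [Fintype ι] [DecidableEq ι] {R S : ι → Type}
    [∀ i, Fintype (S i)] [∀ i, DecidableEq (S i)]
    (Q : (∀ i, R i) → (∀ i, S i) → ℝ) : Prop :=
  ∀ (I : Finset ι) (r r' : ∀ i, R i), (∀ i ∈ I, r i = r' i) →
    ∀ s₀ : ∀ i, S i,
      (∑ s : ∀ i, S i, if ∀ i ∈ I, s i = s₀ i then Q r s else 0) =
      (∑ s : ∀ i, S i, if ∀ i ∈ I, s i = s₀ i then Q r' s else 0)

/-- A correlation `Q` with inputs the types and outputs the actions is a canonical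
communication equilibrium: no player `i` of type `ti` gains by reporting `ri` instead
and transforming the recommended action by `α`. -/
def IsCanonCommEq {ι : Type} [Fintype ι] [DecidableEq ι] {T A : ι → Type}
    [∀ i, Fintype (T i)] [∀ i, Fintype (A i)] [∀ i, DecidableEq (T i)]
    (P : (∀ i, T i) → ℝ) (v : ι → (∀ i, T i) → (∀ i, A i) → ℝ)
    (Q : (∀ i, T i) → (∀ i, A i) → ℝ) : Prop :=
  ∀ (i : ι) (ti ri : T i) (α : A i → A i),
    (∑ t : ∀ j, T j, ∑ a : ∀ j, A j,
      if t i = ti then P t * Q t a * v i t a else 0) ≥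
    ∑ t : ∀ j, T j, ∑ a : ∀ j, A j,
      if t i = ti then
        P t * Q (Function.update t i ri) a * v i t (Function.update a i (α (a i)))
      else 0

/-- The canonical representative `Q̂` of the solution `(f,g,Q)`:
`Q̂(a|t) = ∑_λ Λ(λ) ∑_{s : g(t,s,λ) = a} Q(s | f(t,λ))`. -/
noncomputable def canonRep {ι : Type} [Fintype ι] [DecidableEq ι]
    {T A R S Λ : ι → Type}
    [∀ i, Fintype (S i)] [∀ i, Fintype (Λ i)] [∀ i, DecidableEq (A i)]
    (μ : ∀ i, Λ i → ℝ)
    (f : ∀ i, T i → Λ i → R i) (g : ∀ i, T i → S i → Λ i → A i)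
    (Q : (∀ i, R i) → (∀ i, S i) → ℝ) :
    (∀ i, T i) → (∀ i, A i) → ℝ :=
  fun t a =>
    ∑ lam : ∀ j, Λ j, (∏ j, μ j (lam j)) *
      ∑ s : ∀ j, S j,
        if ∀ j, g j (t j) (s j) (lam j) = a j then Q (fun j => f j (t j) (lam j)) s else 0

section CanonRep

variable {ι : Type} [Fintype ι] [DecidableEq ι] {T A R S Λ : ι → Type}
  [∀ i, Fintype (A i)] [∀ i, DecidableEq (A i)] [∀ i, Fintype (S i)] [∀ i, Fintype (Λ i)]

/-- Integrating against the canonical representative amounts to integrating over the local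
randomness and the outputs of the original correlation. -/
theorem sum_canonRep_mul (μ : ∀ i, Λ i → ℝ)
    (f : ∀ i, T i → Λ i → R i) (g : ∀ i, T i → S i → Λ i → A i)
    (Q : (∀ i, R i) → (∀ i, S i) → ℝ) (t : ∀ i, T i) (F : (∀ i, A i) → ℝ) :
    ∑ a : ∀ j, A j, canonRep μ f g Q t a * F a =
      ∑ lam : ∀ j, Λ j, ∑ s : ∀ j, S j, (∏ j, μ j (lam j)) *
        Q (fun j => f j (t j) (lam j)) s * F (fun j => g j (t j) (s j) (lam j)) := by
  simp only [canonRep, Finset.sum_mul, Finset.mul_sum]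
  rw [Finset.sum_comm]
  refine Finset.sum_congr rfl fun lam _ => ?_
  rw [Finset.sum_comm]
  refine Finset.sum_congr rfl fun s _ => ?_
  rw [Finset.sum_eq_single (fun j => g j (t j) (s j) (lam j))]
  · simp
  · intro a _ ha
    rw [if_neg fun h => ha (funext fun j => (h j).symm)]
    simp
  · simp

theorem isCorrelation_canonRep {μ : ∀ i, Λ i → ℝ}
    (f : ∀ i, T i → Λ i → R i) (g : ∀ i, T i → S i → Λ i → A i)
    {Q : (∀ i, R i) → (∀ i, S i) → ℝ}
    (hμ0 : ∀ i l, 0 ≤ μ i l) (hμ1 : ∀ i, ∑ l : Λ i, μ i l = 1) (hQ : IsCorrelation Q) :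
    IsCorrelation (canonRep μ f g Q) := by
  refine ⟨fun t a => ?_, fun t => ?_⟩
  · refine Finset.sum_nonneg fun lam _ => mul_nonneg
      (Finset.prod_nonneg fun j _ => hμ0 j _) (Finset.sum_nonneg fun s _ => ?_)
    split_ifs
    exacts [hQ.1 _ _, le_rfl]
  · have h := sum_canonRep_mul μ f g Q t fun _ => 1
    simp only [mul_one, ← Finset.mul_sum, hQ.2] at h
    rw [h, ← Fintype.prod_sum]
    simp [hμ1]

variable [∀ i, Fintype (T i)]

theorem sum_canonRep_eq_expPayoff
    (P : (∀ i, T i) → ℝ) (v : ι → (∀ i, T i) → (∀ i, A i) → ℝ) (μ : ∀ i, Λ i → ℝ)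
    (f : ∀ i, T i → Λ i → R i) (g : ∀ i, T i → S i → Λ i → A i)
    (Q : (∀ i, R i) → (∀ i, S i) → ℝ) (i : ι) :
    (∑ t : ∀ j, T j, ∑ a : ∀ j, A j, P t * canonRep μ f g Q t a * v i t a) =
      expPayoff P v μ f g Q i := by
  refine Finset.sum_congr rfl fun t _ => ?_
  simp only [mul_assoc, ← Finset.mul_sum]
  rw [sum_canonRep_mul]
  simp only [mul_assoc, ← Finset.mul_sum]

/-- Misreporting `ri` and transforming the recommended action by `α`, when of type `ti`, is
realized in the original solution by a deviation of player `i`. -/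
theorem sum_canonRep_eq_devPayoff [∀ i, DecidableEq (T i)]
    (P : (∀ i, T i) → ℝ) (v : ι → (∀ i, T i) → (∀ i, A i) → ℝ) (μ : ∀ i, Λ i → ℝ)
    (f : ∀ i, T i → Λ i → R i) (g : ∀ i, T i → S i → Λ i → A i)
    (Q : (∀ i, R i) → (∀ i, S i) → ℝ) (i : ι) (ti ri : T i) (α : A i → A i) :
    (∑ t : ∀ j, T j, ∑ a : ∀ j, A j,
      if t i = ti then
        P t * canonRep μ f g Q (Function.update t i ri) a *
          v i t (Function.update a i (α (a i)))
      else P t * canonRep μ f g Q t a * v i t a) =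
      devPayoff P v μ f g Q i
        (fun t l => if t = ti then f i ri l else f i t l)
        (fun t s l => if t = ti then α (g i ri s l) else g i t s l) := by
  refine Finset.sum_congr rfl fun t _ => ?_
  by_cases h : t i = ti
  · simp only [h, if_true, mul_assoc, ← Finset.mul_sum]
    rw [sum_canonRep_mul μ f g Q _ fun a => v i t (Function.update a i (α (a i)))]
    simp only [mul_assoc, ← Finset.mul_sum]
    refine congrArg _ (Finset.sum_congr rfl fun lam _ => congrArg _ (Finset.sum_congr rfl
      fun s _ => congrArg₂ _ (congrArg (Q · s) ?_) (congrArg (v i t) ?_)))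
    · funext j
      rcases eq_or_ne j i with rfl | hj <;> simp [*]
    · funext j
      rcases eq_or_ne j i with rfl | hj <;> simp [*]
  · simp only [h, if_false, mul_assoc, ← Finset.mul_sum]
    rw [sum_canonRep_mul]
    simp only [mul_assoc, ← Finset.mul_sum]
    refine congrArg _ (Finset.sum_congr rfl fun lam _ => congrArg _ (Finset.sum_congr rfl
      fun s _ => congrArg₂ _ (congrArg (Q · s) ?_) (congrArg (v i t) ?_)))
    · exact (Function.update_eq_self i fun j => f j (t j) (lam j)).symm
    · exact (Function.update_eq_self i fun j => g j (t j) (s j) (lam j)).symm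

theorem IsCommEq.isCanonCommEq_canonRep [∀ i, DecidableEq (T i)]
    {P : (∀ i, T i) → ℝ} {v : ι → (∀ i, T i) → (∀ i, A i) → ℝ} {μ : ∀ i, Λ i → ℝ}
    {f : ∀ i, T i → Λ i → R i} {g : ∀ i, T i → S i → Λ i → A i}
    {Q : (∀ i, R i) → (∀ i, S i) → ℝ} (hEq : IsCommEq P v μ f g Q) :
    IsCanonCommEq P v (canonRep μ f g Q) := by
  intro i ti ri α
  have h := hEq i (fun t l => if t = ti then f i ri l else f i t l)
    (fun t s l => if t = ti then α (g i ri s l) else g i t s l)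
  rw [← sum_canonRep_eq_devPayoff, ← sum_canonRep_eq_expPayoff, ge_iff_le, ← sub_nonneg] at h
  rw [ge_iff_le, ← sub_nonneg]
  refine h.trans_eq ?_
  simp only [← Finset.sum_sub_distrib]
  refine Finset.sum_congr rfl fun t _ => Finset.sum_congr rfl fun a _ => ?_
  split_ifs <;> simp

end CanonRep

/-- the canonical representative of a communication equilibrium is a
correlation with inputs the types and outputs the actions, it is a canonical
communication equilibrium, and it has the same expected payoffs. -/
theorem stmt1 {ι : Type} [Fintype ι] [DecidableEq ι]
    {T A R S Λ : ι → Type}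
    [∀ i, Fintype (T i)] [∀ i, Nonempty (T i)] [∀ i, DecidableEq (T i)]
    [∀ i, Fintype (A i)] [∀ i, Nonempty (A i)] [∀ i, DecidableEq (A i)]
    [∀ i, Fintype (S i)] [∀ i, Fintype (Λ i)] [∀ i, Nonempty (Λ i)]
    (P : (∀ i, T i) → ℝ) (v : ι → (∀ i, T i) → (∀ i, A i) → ℝ)
    (μ : ∀ i, Λ i → ℝ)
    (f : ∀ i, T i → Λ i → R i) (g : ∀ i, T i → S i → Λ i → A i)
    (Q : (∀ i, R i) → (∀ i, S i) → ℝ)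
    (hP0 : ∀ t, 0 ≤ P t) (hP1 : ∑ t : ∀ i, T i, P t = 1)
    (hμ0 : ∀ i l, 0 ≤ μ i l) (hμ1 : ∀ i, ∑ l : Λ i, μ i l = 1)
    (hQ : IsCorrelation Q)
    (hEq : IsCommEq P v μ f g Q) :
    IsCorrelation (canonRep μ f g Q) ∧
    IsCanonCommEq P v (canonRep μ f g Q) ∧
    ∀ i : ι,
      (∑ t : ∀ j, T j, ∑ a : ∀ j, A j, P t * canonRep μ f g Q t a * v i t a) =
        expPayoff P v μ f g Q i := by
  exact ⟨isCorrelation_canonRep f g hμ0 hμ1 hQ, hEq.isCanonCommEq_canonRep,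
    sum_canonRep_eq_expPayoff P v μ f g Q⟩
end

section
/- Let (g,Q) be a correlated equilibrium of a finite Bayesian game G, with advice distribution Q on S = S_1 × ⋯ × S_n. Define the probability distribution Q̃ on Σ = Σ_1 × ⋯ × Σ_n, where Σ_i is the set of all functions σ_i : T_i → A_i, by Q̃(σ) = ∑_{s : g_i(·,s_i) = σ_i for all i} Q(s), and let ev_i : T_i × Σ_i → A_i be the evaluation map ev_i(t_i,σ_i) = σ_i(t_i). Then (ev, Q̃) is a correlated equilibrium of G, and it induces the same conditional distribution of actions given types as (g,Q): for all t ∈ T and a ∈ A, ∑_{σ : σ_i(t_i)=a_i for all i} Q̃(σ) = ∑_{s : g_i(t_i,s_i)=a_i for all i} Q(s). -/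
open Finset

/-- `(g,Q)` is a correlated equilibrium of the Bayesian game with prior `P` and
payoffs `v`: the advice distribution `Q` on `S` is independent of the types, and no
player `i` gains by unilaterally playing `δ (t i) (s i)` instead of `g i (t i) (s i)`. -/
def IsCorrelatedEq {ι : Type} [Fintype ι] [DecidableEq ι] {T A S : ι → Type}
    [∀ i, Fintype (T i)] [∀ i, Fintype (S i)]
    (P : (∀ i, T i) → ℝ) (v : ι → (∀ i, T i) → (∀ i, A i) → ℝ)
    (g : ∀ i, T i → S i → A i) (Q : (∀ i, S i) → ℝ) : Prop :=
  ∀ (i : ι) (δ : T i → S i → A i),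
    (∑ t : ∀ j, T j, ∑ s : ∀ j, S j,
      P t * Q s * v i t (fun j => g j (t j) (s j))) ≥
    ∑ t : ∀ j, T j, ∑ s : ∀ j, S j,
      P t * Q s * v i t (Function.update (fun j => g j (t j) (s j)) i (δ (t i) (s i)))

/-- Change of variables for the pushforward of `Q` along `s ↦ (g i (·, s i))_i`. -/
theorem sum_pushforward_mul {ι : Type} [Fintype ι] [DecidableEq ι] {T A S : ι → Type}
    [∀ i, Fintype (T i)] [∀ i, DecidableEq (T i)] [∀ i, Fintype (A i)]
    [∀ i, DecidableEq (A i)] [∀ i, Fintype (S i)]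
    (g : ∀ i, T i → S i → A i) (Q : (∀ i, S i) → ℝ) (F : (∀ i, T i → A i) → ℝ) :
    ∑ σ : ∀ i, T i → A i,
      (∑ s : ∀ j, S j, if ∀ i ti, g i ti (s i) = σ i ti then Q s else 0) * F σ =
    ∑ s : ∀ j, S j, Q s * F (fun i ti => g i ti (s i)) := by
  simp_rw [Finset.sum_mul]
  rw [Finset.sum_comm]
  refine Finset.sum_congr rfl fun s _ => ?_
  rw [Finset.sum_eq_single (fun i ti => g i ti (s i))]
  · simp
  · intro σ _ hσ
    rw [if_neg, zero_mul]
    intro h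
    exact hσ (funext fun i => funext fun ti => (h i ti).symm)
  · simp

/-- passing to standard form. Given a correlated equilibrium `(g,Q)`,
the distribution `Q̃` on profiles of functions `σ i : T i → A i` given by
`Q̃(σ) = ∑_{s : g i (·, s i) = σ i ∀ i} Q s`, together with the evaluation maps
`(ti, σi) ↦ σi ti`, is a correlated equilibrium inducing the same conditional
distribution of actions given types. -/
theorem stmt6 {ι : Type} [Fintype ι] [DecidableEq ι] {T A S : ι → Type}
    [∀ i, Fintype (T i)] [∀ i, Nonempty (T i)] [∀ i, DecidableEq (T i)]
    [∀ i, Fintype (A i)] [∀ i, Nonempty (A i)] [∀ i, DecidableEq (A i)]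
    [∀ i, Fintype (S i)]
    (P : (∀ i, T i) → ℝ) (v : ι → (∀ i, T i) → (∀ i, A i) → ℝ)
    (g : ∀ i, T i → S i → A i) (Q : (∀ i, S i) → ℝ)
    (hP0 : ∀ t, 0 ≤ P t) (hP1 : ∑ t : ∀ i, T i, P t = 1)
    (hQ0 : ∀ s, 0 ≤ Q s) (hQ1 : ∑ s : ∀ i, S i, Q s = 1)
    (hEq : IsCorrelatedEq P v g Q) :
    IsCorrelatedEq P v (fun i (ti : T i) (σi : T i → A i) => σi ti)
      (fun σ : ∀ i, T i → A i =>
        ∑ s : ∀ j, S j, if ∀ i ti, g i ti (s i) = σ i ti then Q s else 0) ∧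
    ∀ (t : ∀ i, T i) (a : ∀ i, A i),
      (∑ σ : ∀ i, T i → A i,
        if ∀ i, σ i (t i) = a i then
          (∑ s : ∀ j, S j, if ∀ i ti, g i ti (s i) = σ i ti then Q s else 0)
        else 0) =
      ∑ s : ∀ j, S j, if ∀ i, g i (t i) (s i) = a i then Q s else 0 := by
  refine ⟨fun i δ => ?_, fun t a => ?_⟩
  · have h := hEq i fun ti si => δ ti fun t' => g i t' si
    simp_rw [mul_assoc, ← Finset.mul_sum] at h ⊢
    simp_rw [sum_pushforward_mul g Q]
    exact h
  · have h := sum_pushforward_mul g Q fun σ => if ∀ i, σ i (t i) = a i then 1 else 0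
    simpa only [mul_ite, mul_one, mul_zero] using h
end

section
/- Let (g¹,Q_1) and (g²,Q_2) be correlated equilibria of the same finite Bayesian game G, with advice sets S¹_i and S²_i respectively, and let 0 ≤ p ≤ 1. Define new advice sets S_i = S¹_i ⊔ S²_i (disjoint union), the distribution Q on S = S_1 × ⋯ × S_n by: Q(s) = p·Q_1(s¹) if every component s_i lies in the first summand and s¹ is the corresponding element of S¹; Q(s) = (1−p)·Q_2(s²) if every component s_i lies in the second summand and s² is the corresponding element of S²; and Q(s) = 0 otherwise; and the functions g_i : T_i × S_i → A_i by g_i(t_i,s_i) = g¹_i(t_i,s_i) when s_i comes from S¹_i and g_i(t_i,s_i) = g²_i(t_i,s_i) when s_i comes from S²_i. Then (g,Q) is a correlated equilibrium of G. -/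
open Finset

/-- Summing a mixture `Q` on the disjoint union of advice sets against `F`. -/
theorem sum_sumElim_mixture {ι : Type} [Fintype ι] [DecidableEq ι] [Nonempty ι]
    {S₁ S₂ : ι → Type} [∀ i, Fintype (S₁ i)] [∀ i, Fintype (S₂ i)]
    {Q₁ : (∀ i, S₁ i) → ℝ} {Q₂ : (∀ i, S₂ i) → ℝ} {Q : (∀ i, S₁ i ⊕ S₂ i) → ℝ} {a b : ℝ}
    (hQl : ∀ s₁ : ∀ i, S₁ i, Q (fun i => Sum.inl (s₁ i)) = a * Q₁ s₁)
    (hQr : ∀ s₂ : ∀ i, S₂ i, Q (fun i => Sum.inr (s₂ i)) = b * Q₂ s₂)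
    (hQ0 : ∀ s : ∀ i, S₁ i ⊕ S₂ i,
      ¬ (∀ i, (s i).isLeft = true) → ¬ (∀ i, (s i).isRight = true) → Q s = 0)
    (c : ℝ) (F : (∀ i, S₁ i ⊕ S₂ i) → ℝ) :
    ∑ s, c * Q s * F s =
      a * ∑ s₁, c * Q₁ s₁ * F (fun i => Sum.inl (s₁ i)) +
        b * ∑ s₂, c * Q₂ s₂ * F (fun i => Sum.inr (s₂ i)) := by
  let e : (∀ i, S₁ i) ⊕ (∀ i, S₂ i) → ∀ i, S₁ i ⊕ S₂ i :=
    Sum.elim (fun s₁ i => Sum.inl (s₁ i)) (fun s₂ i => Sum.inr (s₂ i))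
  have he : Function.Injective e := by
    obtain ⟨i⟩ := ‹Nonempty ι›
    rintro (x | x) (y | y) h
    · exact congrArg Sum.inl (funext fun j => Sum.inl_injective (congrFun h j))
    · exact absurd (congrFun h i) Sum.inl_ne_inr
    · exact absurd (congrFun h i) Sum.inr_ne_inl
    · exact congrArg Sum.inr (funext fun j => Sum.inr_injective (congrFun h j))
  rw [← Fintype.sum_of_injective e he (fun x => c * Q (e x) * F (e x)) _ ?_ fun _ => rfl,
    Fintype.sum_sum_type, Finset.mul_sum, Finset.mul_sum]
  · congr 1
    · refine Finset.sum_congr rfl fun s₁ _ => ?_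
      simp only [e, Sum.elim_inl, hQl]
      ring
    · refine Finset.sum_congr rfl fun s₂ _ => ?_
      simp only [e, Sum.elim_inr, hQr]
      ring
  · intro s hs
    rw [hQ0 s, mul_zero, zero_mul]
    · exact fun h => hs ⟨Sum.inl fun i => (s i).getLeft (h i), funext fun i => by simp [e]⟩
    · exact fun h => hs ⟨Sum.inr fun i => (s i).getRight (h i), funext fun i => by simp [e]⟩

/-- convex combination of two correlated equilibria, using the disjoint
union of the advice sets: the resulting `(g,Q)` is a correlated equilibrium. -/
theorem stmt7 {ι : Type} [Fintype ι] [DecidableEq ι] {T A S₁ S₂ : ι → Type}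
    [∀ i, Fintype (T i)] [∀ i, Nonempty (T i)]
    [∀ i, Fintype (A i)] [∀ i, Nonempty (A i)]
    [∀ i, Fintype (S₁ i)] [∀ i, Fintype (S₂ i)]
    (P : (∀ i, T i) → ℝ) (v : ι → (∀ i, T i) → (∀ i, A i) → ℝ)
    (g₁ : ∀ i, T i → S₁ i → A i) (Q₁ : (∀ i, S₁ i) → ℝ)
    (g₂ : ∀ i, T i → S₂ i → A i) (Q₂ : (∀ i, S₂ i) → ℝ)
    (hP0 : ∀ t, 0 ≤ P t) (hP1 : ∑ t : ∀ i, T i, P t = 1)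
    (hQ₁0 : ∀ s, 0 ≤ Q₁ s) (hQ₁1 : ∑ s : ∀ i, S₁ i, Q₁ s = 1)
    (hQ₂0 : ∀ s, 0 ≤ Q₂ s) (hQ₂1 : ∑ s : ∀ i, S₂ i, Q₂ s = 1)
    (hE₁ : IsCorrelatedEq P v g₁ Q₁) (hE₂ : IsCorrelatedEq P v g₂ Q₂)
    (p : ℝ) (hp0 : 0 ≤ p) (hp1 : p ≤ 1)
    (Q : (∀ i, S₁ i ⊕ S₂ i) → ℝ)
    (hQl : ∀ s₁ : ∀ i, S₁ i, Q (fun i => Sum.inl (s₁ i)) = p * Q₁ s₁)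
    (hQr : ∀ s₂ : ∀ i, S₂ i, Q (fun i => Sum.inr (s₂ i)) = (1 - p) * Q₂ s₂)
    (hQ0 : ∀ s : ∀ i, S₁ i ⊕ S₂ i,
      ¬ (∀ i, (s i).isLeft = true) → ¬ (∀ i, (s i).isRight = true) → Q s = 0) :
    IsCorrelatedEq P v (fun i ti si => Sum.elim (g₁ i ti) (g₂ i ti) si) Q := by
  intro i δ
  have : Nonempty ι := ⟨i⟩
  simp only [sum_sumElim_mixture hQl hQr hQ0, Finset.sum_add_distrib, ← Finset.mul_sum,
    Sum.elim_inl, Sum.elim_inr]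
  exact add_le_add
    (mul_le_mul_of_nonneg_left (hE₁ i fun ti si => δ ti (Sum.inl si)) hp0)
    (mul_le_mul_of_nonneg_left (hE₂ i fun ti si => δ ti (Sum.inr si)) (sub_nonneg.mpr hp1))
end

section
/- Let G be a finite Bayesian game and (M,ρ) a quantum solution of G. Then (M,ρ) is a quantum correlated equilibrium if and only if for every player i, every single type t_i ∈ T_i, and every single POVM N = (N_{a_i})_{a_i ∈ A_i} on ℂ^{d_i}: ∑_{t_{-i},a} P(t) Tr(ρ · (M^{t_1}_{a_1} ⊗ ⋯ ⊗ M^{t_{i-1}}_{a_{i-1}} ⊗ N_{a_i} ⊗ M^{t_{i+1}}_{a_{i+1}} ⊗ ⋯ ⊗ M^{t_n}_{a_n})) v_i(t,a) ≤ ∑_{t_{-i},a} P(t) Tr(ρ · (M^{t_1}_{a_1} ⊗ ⋯ ⊗ M^{t_n}_{a_n})) v_i(t,a), where the sums range over the other players' types t_{-i} and all action profiles a. -/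
open Finset ComplexOrder

/-- Tensor product of a finite family of square complex matrices:
`(K₁ ⊗ ⋯ ⊗ Kₙ)(x,y) = ∏ i, Kᵢ (x i) (y i)`. -/
def tensorFam {ι : Type} [Fintype ι] {n : ι → Type}
    (K : ∀ i, Matrix (n i) (n i) ℂ) :
    Matrix (∀ i, n i) (∀ i, n i) ℂ :=
  Matrix.of fun x y => ∏ i, K i (x i) (y i)

/-- A POVM with outcome set `O`: positive semidefinite matrices summing to the identity. -/
def IsPOVM {n : Type} [Fintype n] [DecidableEq n] {O : Type} [Fintype O]
    (M : O → Matrix n n ℂ) : Prop :=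
  (∀ o, (M o).PosSemidef) ∧ ∑ o, M o = 1

/-- Payoffs summed over type profiles split according to the type of one player. -/
theorem sum_sum_eq_sum_sum_sum_ite {X Y τ : Type} [Fintype X] [Fintype Y] [Fintype τ]
    [DecidableEq τ] (π : X → τ) (f : X → Y → ℝ) :
    ∑ x, ∑ y, f x y = ∑ s, ∑ x, ∑ y, if π x = s then f x y else 0 := by
  symm
  rw [Finset.sum_comm]
  refine Finset.sum_congr rfl fun x _ => ?_
  rw [Finset.sum_comm]
  simp

/-- Changing a function only where `p` holds increases its sum by the increase over `p`. -/
theorem sum_sum_ite_le_iff {X Y : Type} [Fintype X] [Fintype Y]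
    (p : X → Prop) [DecidablePred p] (f g : X → Y → ℝ) :
    (∑ x, ∑ y, if p x then f x y else g x y) ≤ ∑ x, ∑ y, g x y ↔
      (∑ x, ∑ y, if p x then f x y else 0) ≤ ∑ x, ∑ y, if p x then g x y else 0 := by
  have h : (∑ x, ∑ y, if p x then f x y else g x y) - ∑ x, ∑ y, g x y =
      (∑ x, ∑ y, if p x then f x y else 0) - ∑ x, ∑ y, if p x then g x y else 0 := by
    rw [← Finset.sum_sub_distrib, ← Finset.sum_sub_distrib]
    refine Finset.sum_congr rfl fun x _ => ?_
    split_ifs <;> simp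
  rw [← sub_nonpos, h, sub_nonpos]

/-- a quantum solution `(M,ρ)` is a quantum correlated equilibrium iff
for every player `i`, every single type `ti` and every single POVM `N`, the deviation
where player `i` measures with `N` on type `ti` (and with `M` otherwise) does not
increase his expected payoff on the event `t i = ti`. -/
theorem stmt9 {ι : Type} [Fintype ι] [DecidableEq ι]
    {T A : ι → Type}
    [∀ i, Fintype (T i)] [∀ i, Nonempty (T i)] [∀ i, DecidableEq (T i)]
    [∀ i, Fintype (A i)] [∀ i, Nonempty (A i)]
    (P : (∀ i, T i) → ℝ) (v : ι → (∀ i, T i) → (∀ i, A i) → ℝ)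
    (hP0 : ∀ t, 0 ≤ P t) (hP1 : ∑ t : ∀ i, T i, P t = 1)
    (d : ι → ℕ) (hd : ∀ i, 1 ≤ d i)
    (ρ : Matrix (∀ i, Fin (d i)) (∀ i, Fin (d i)) ℂ)
    (hρ : ρ.PosSemidef) (hρtr : ρ.trace = 1)
    (M : ∀ i, T i → A i → Matrix (Fin (d i)) (Fin (d i)) ℂ)
    (hM : ∀ i ti, IsPOVM (M i ti)) :
    (∀ (i : ι) (N : T i → A i → Matrix (Fin (d i)) (Fin (d i)) ℂ),
      (∀ ti, IsPOVM (N ti)) →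
      (∑ t : ∀ j, T j, ∑ a : ∀ j, A j,
        P t *
          ((ρ * tensorFam
            (Function.update (fun j => M j (t j) (a j)) i (N (t i) (a i)))).trace).re *
          v i t a) ≤
      ∑ t : ∀ j, T j, ∑ a : ∀ j, A j,
        P t * ((ρ * tensorFam (fun j => M j (t j) (a j))).trace).re * v i t a) ↔
    (∀ (i : ι) (ti : T i) (N : A i → Matrix (Fin (d i)) (Fin (d i)) ℂ),
      IsPOVM N →
      (∑ t : ∀ j, T j, ∑ a : ∀ j, A j,
        if t i = ti then
          P t *
            ((ρ * tensorFam
              (Function.update (fun j => M j (t j) (a j)) i (N (a i)))).trace).re *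
            v i t a
        else 0) ≤
      ∑ t : ∀ j, T j, ∑ a : ∀ j, A j,
        if t i = ti then
          P t * ((ρ * tensorFam (fun j => M j (t j) (a j))).trace).re * v i t a
        else 0) := by
  constructor
  · intro h i ti N hN
    have key := h i (Function.update (M i) ti N) fun s => by
      by_cases hs : s = ti
      · subst hs
        simpa using hN
      · simpa [hs] using hM i s
    refine (sum_sum_ite_le_iff (fun t : ∀ j, T j => t i = ti) _ _).1 (le_trans (le_of_eq ?_) key)
    refine Finset.sum_congr rfl fun t _ => Finset.sum_congr rfl fun a _ => ?_
    split_ifs with ht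
    · rw [ht, Function.update_self]
    · rw [Function.update_of_ne ht, Function.update_eq_self i fun j => M j (t j) (a j)]
  · intro h i N hN
    rw [sum_sum_eq_sum_sum_sum_ite (fun t : ∀ j, T j => t i),
      sum_sum_eq_sum_sum_sum_ite (fun t : ∀ j, T j => t i)
        fun t a => P t * ((ρ * tensorFam (fun j => M j (t j) (a j))).trace).re * v i t a]
    refine Finset.sum_le_sum fun ti _ => le_trans (le_of_eq ?_) (h i ti (N ti) (hN ti))
    refine Finset.sum_congr rfl fun t _ => Finset.sum_congr rfl fun a _ => ?_
    split_ifs with ht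
    · rw [ht]
    · rfl
end

section
/- Let (g,Q) be a correlated equilibrium of a finite Bayesian game G, with advice distribution Q on S = S_1 × ⋯ × S_n. Define the quantum solution with d_i = |S_i|: ρ the diagonal matrix indexed by S with diagonal entries ρ(s,s) = Q(s), and for each player i, type t_i and action a_i the diagonal matrix M^{t_i}_{a_i} indexed by S_i with diagonal entries (M^{t_i}_{a_i})(s_i,s_i) = 1 if g_i(t_i,s_i) = a_i and 0 otherwise. Then ρ is a state, each M^{t_i} = (M^{t_i}_{a_i})_{a_i} is a POVM, (M,ρ) is a quantum correlated equilibrium of G, and its canonical correlation satisfies Tr(ρ · (M^{t_1}_{a_1} ⊗ ⋯ ⊗ M^{t_n}_{a_n})) = ∑_{s : g_i(t_i,s_i)=a_i for all i} Q(s) for all t and a; in particular each player's expected payoff in (M,ρ) equals their expected payoff in (g,Q). -/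
open Finset ComplexOrder

theorem trace_diagonal_mul_tensorFam {ι : Type} [Fintype ι] [DecidableEq ι] {S : ι → Type}
    [∀ i, Fintype (S i)] [∀ i, DecidableEq (S i)] (q : (∀ i, S i) → ℂ)
    (K : ∀ i, Matrix (S i) (S i) ℂ) :
    (Matrix.diagonal q * tensorFam K).trace = ∑ s : ∀ i, S i, q s * ∏ i, K i (s i) (s i) := by
  simp [Matrix.trace, Matrix.diagonal_mul, tensorFam]

theorem isPOVM_diagonal_indicator {n O : Type} [Fintype n] [DecidableEq n] [Fintype O]
    [DecidableEq O] (f : n → O) :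
    IsPOVM fun o => Matrix.diagonal fun x => if f x = o then (1 : ℂ) else 0 := by
  refine ⟨fun o => Matrix.PosSemidef.diagonal fun x => ?_, ?_⟩
  · by_cases h : f x = o <;> simp [h]
  · ext x y
    by_cases h : x = y
    · subst h
      simp [Matrix.sum_apply]
    · simp [Matrix.sum_apply, h]

theorem IsPOVM.re_diag_nonneg {n O : Type} [Fintype n] [DecidableEq n] [Fintype O]
    {M : O → Matrix n n ℂ} (hM : IsPOVM M) (o : O) (x : n) : 0 ≤ (M o x x).re :=
  (Complex.nonneg_iff.1 (hM.1 o).diag_nonneg).1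

theorem IsPOVM.sum_re_diag {n O : Type} [Fintype n] [DecidableEq n] [Fintype O]
    {M : O → Matrix n n ℂ} (hM : IsPOVM M) (x : n) : ∑ o, (M o x x).re = 1 := by
  have h := congrArg (fun A : Matrix n n ℂ => (A x x).re) hM.2
  simpa [Matrix.sum_apply] using h

/-- Diagonal entries of a tensor product of indicator matrices whose `i`-th factor is replaced. -/
theorem prod_update_diagonal_indicator {ι : Type} [Fintype ι] [DecidableEq ι] {A S : ι → Type}
    [∀ i, DecidableEq (A i)] [∀ i, DecidableEq (S i)]
    (f : ∀ i, S i → A i) (a : ∀ i, A i) (s : ∀ i, S i) (i : ι) (N : Matrix (S i) (S i) ℂ) :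
    ∏ j, Function.update
        (fun j => Matrix.diagonal fun x : S j => if f j x = a j then (1 : ℂ) else 0)
        i N j (s j) (s j) =
      if ∀ j, j ≠ i → f j (s j) = a j then N (s i) (s i) else 0 := by
  rw [← Finset.mul_prod_erase _ _ (Finset.mem_univ i), Function.update_self]
  have h : ∀ j ∈ Finset.univ.erase i, Function.update
        (fun j => Matrix.diagonal fun x : S j => if f j x = a j then (1 : ℂ) else 0)
        i N j (s j) (s j) = if f j (s j) = a j then 1 else 0 := by
    intro j hj
    rw [Function.update_of_ne (Finset.ne_of_mem_erase hj), Matrix.diagonal_apply_eq]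
  rw [Finset.prod_congr rfl h, Finset.prod_boole]
  simp

theorem sum_ite_eq_off_coordinate {ι : Type} [Fintype ι] [DecidableEq ι] {A : ι → Type}
    [∀ i, Fintype (A i)] [∀ i, DecidableEq (A i)] (c : ∀ i, A i) (i : ι) (F : (∀ i, A i) → ℝ) :
    (∑ a : ∀ j, A j, if ∀ j, j ≠ i → c j = a j then F a else 0) =
      ∑ b : A i, F (Function.update c i b) := by
  rw [← Finset.sum_filter]
  refine Finset.sum_nbij' (fun a => a i) (fun b => Function.update c i b) ?_ ?_ ?_ ?_ ?_
  · simp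
  · intro b _
    simp +contextual
  · intro a ha
    have ha' := (Finset.mem_filter.1 ha).2
    funext j
    by_cases h : j = i
    · subst h
      simp
    · simp [h, ha' j h]
  · simp
  · intro a ha
    have ha' := (Finset.mem_filter.1 ha).2
    congr 1
    funext j
    by_cases h : j = i
    · subst h
      simp
    · simp [h, ha' j h]

/-- A randomized local deviation, with outcome probabilities `w` depending on the own type and
advice, does no better than some deterministic local deviation. -/
theorem exists_deterministic_deviation {X Y Z B : Type} [Fintype X] [Fintype Y] [Fintype Z]
    [Fintype B] [Nonempty B] (x : Z → X) (y : Z → Y) (u : Z → B → ℝ) (w : X → Y → B → ℝ)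
    (hw0 : ∀ p q b, 0 ≤ w p q b) (hw1 : ∀ p q, ∑ b, w p q b = 1) :
    ∃ δ : X → Y → B, ∑ z, ∑ b, w (x z) (y z) b * u z b ≤ ∑ z, u z (δ (x z) (y z)) := by
  classical
  let F : X × Y → B → ℝ := fun p b => ∑ z with (x z, y z) = p, u z b
  choose δ hδ using fun p => Finite.exists_max (F p)
  refine ⟨fun p q => δ (p, q), ?_⟩
  calc ∑ z, ∑ b, w (x z) (y z) b * u z b
      = ∑ p : X × Y, ∑ z with (x z, y z) = p, ∑ b, w (x z) (y z) b * u z b :=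
        (Finset.sum_fiberwise _ _ _).symm
    _ = ∑ p : X × Y, ∑ b, w p.1 p.2 b * F p b := by
        refine Finset.sum_congr rfl fun p _ => ?_
        rw [Finset.sum_comm]
        refine Finset.sum_congr rfl fun b _ => ?_
        rw [Finset.mul_sum]
        refine Finset.sum_congr rfl fun z hz => ?_
        rw [← (Finset.mem_filter.1 hz).2]
    _ ≤ ∑ p : X × Y, ∑ b, w p.1 p.2 b * F p (δ p) := by
        gcongr with p _ b _
        · exact hw0 _ _ _
        · exact hδ p b
    _ = ∑ p : X × Y, ∑ z with (x z, y z) = p, u z (δ (x z, y z)) := by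
        refine Finset.sum_congr rfl fun p _ => ?_
        rw [← Finset.sum_mul, hw1, one_mul]
        refine Finset.sum_congr rfl fun z hz => ?_
        rw [(Finset.mem_filter.1 hz).2]
    _ = ∑ z, u z (δ (x z, y z)) := Finset.sum_fiberwise _ _ _

/-- embedding a correlated equilibrium `(g,Q)` into a quantum
correlated equilibrium with diagonal state `ρ = diag(Q)` and projective diagonal
measurements `M^{t_i}_{a_i} = diag(1_{g_i(t_i, ·) = a_i})`. -/
theorem stmt10 {ι : Type} [Fintype ι] [DecidableEq ι] {T A S : ι → Type}
    [∀ i, Fintype (T i)] [∀ i, Nonempty (T i)]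
    [∀ i, Fintype (A i)] [∀ i, Nonempty (A i)] [∀ i, DecidableEq (A i)]
    [∀ i, Fintype (S i)] [∀ i, DecidableEq (S i)]
    (P : (∀ i, T i) → ℝ) (v : ι → (∀ i, T i) → (∀ i, A i) → ℝ)
    (g : ∀ i, T i → S i → A i) (Q : (∀ i, S i) → ℝ)
    (hP0 : ∀ t, 0 ≤ P t) (hP1 : ∑ t : ∀ i, T i, P t = 1)
    (hQ0 : ∀ s, 0 ≤ Q s) (hQ1 : ∑ s : ∀ i, S i, Q s = 1)
    (hEq : IsCorrelatedEq P v g Q)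
    (ρ : Matrix (∀ i, S i) (∀ i, S i) ℂ)
    (hρdef : ρ = Matrix.diagonal (fun s : ∀ i, S i => (Q s : ℂ)))
    (M : ∀ i, T i → A i → Matrix (S i) (S i) ℂ)
    (hMdef : ∀ i ti ai,
      M i ti ai = Matrix.diagonal (fun si : S i => if g i ti si = ai then 1 else 0)) :
    ρ.PosSemidef ∧ ρ.trace = 1 ∧
    (∀ i ti, IsPOVM (M i ti)) ∧
    (∀ (i : ι) (N : T i → A i → Matrix (S i) (S i) ℂ),
      (∀ ti, IsPOVM (N ti)) →
      (∑ t : ∀ j, T j, ∑ a : ∀ j, A j,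
        P t *
          ((ρ * tensorFam
            (Function.update (fun j => M j (t j) (a j)) i (N (t i) (a i)))).trace).re *
          v i t a) ≤
      ∑ t : ∀ j, T j, ∑ a : ∀ j, A j,
        P t * ((ρ * tensorFam (fun j => M j (t j) (a j))).trace).re * v i t a) ∧
    (∀ (t : ∀ i, T i) (a : ∀ i, A i),
      (ρ * tensorFam (fun j => M j (t j) (a j))).trace =
        ((∑ s : ∀ j, S j, if ∀ j, g j (t j) (s j) = a j then Q s else 0 : ℝ) : ℂ)) ∧
    (∀ i : ι,
      (∑ t : ∀ j, T j, ∑ a : ∀ j, A j,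
        P t * ((ρ * tensorFam (fun j => M j (t j) (a j))).trace).re * v i t a) =
      ∑ t : ∀ j, T j, ∑ s : ∀ j, S j,
        P t * Q s * v i t (fun j => g j (t j) (s j))) := by
  obtain rfl : M = fun i ti ai =>
      Matrix.diagonal (fun si : S i => if g i ti si = ai then 1 else 0) := by
    funext i ti ai
    exact hMdef i ti ai
  subst hρdef
  have hcorr : ∀ (t : ∀ i, T i) (a : ∀ i, A i),
      (Matrix.diagonal (fun s : ∀ i, S i => (Q s : ℂ)) * tensorFam (fun j =>
        Matrix.diagonal (fun x : S j => if g j (t j) x = a j then (1 : ℂ) else 0))).trace =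
        ((∑ s : ∀ j, S j, if ∀ j, g j (t j) (s j) = a j then Q s else 0 : ℝ) : ℂ) := by
    intro t a
    rw [trace_diagonal_mul_tensorFam, Complex.ofReal_sum]
    refine Finset.sum_congr rfl fun s _ => ?_
    simp only [Matrix.diagonal_apply_eq, Finset.prod_boole, Finset.mem_univ, true_imp_iff]
    split_ifs <;> simp
  have hpay : ∀ i : ι,
      (∑ t : ∀ j, T j, ∑ a : ∀ j, A j,
        P t * ((Matrix.diagonal (fun s : ∀ i, S i => (Q s : ℂ)) * tensorFam (fun j =>
          Matrix.diagonal (fun x : S j =>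
            if g j (t j) x = a j then (1 : ℂ) else 0))).trace).re * v i t a) =
      ∑ t : ∀ j, T j, ∑ s : ∀ j, S j,
        P t * Q s * v i t (fun j => g j (t j) (s j)) := by
    intro i
    refine Finset.sum_congr rfl fun t _ => ?_
    simp only [hcorr, Complex.ofReal_re, Finset.mul_sum, Finset.sum_mul]
    rw [Finset.sum_comm]
    refine Finset.sum_congr rfl fun s _ => ?_
    simp [← funext_iff]
  refine ⟨Matrix.PosSemidef.diagonal fun s => ?_, ?_,
    fun i ti => isPOVM_diagonal_indicator (g i ti), ?_, hcorr, hpay⟩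
  · simpa using hQ0 s
  · rw [Matrix.trace_diagonal, ← Complex.ofReal_sum, hQ1, Complex.ofReal_one]
  intro i N hN
  obtain ⟨δ, hδ⟩ := exists_deterministic_deviation
    (fun z : (∀ j, T j) × (∀ j, S j) => z.1 i) (fun z => z.2 i)
    (fun z b => P z.1 * Q z.2 *
      v i z.1 (Function.update (fun j => g j (z.1 j) (z.2 j)) i b))
    (fun p q b => (N p b q q).re) (fun p q b => (hN p).re_diag_nonneg b q)
    (fun p q => (hN p).sum_re_diag q)
  simp only [Fintype.sum_prod_type] at hδ
  rw [hpay]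
  refine le_trans (le_of_eq ?_) (hδ.trans (hEq i δ))
  refine Finset.sum_congr rfl fun t _ => ?_
  simp only [trace_diagonal_mul_tensorFam, prod_update_diagonal_indicator (fun j => g j (t j)),
    Complex.re_sum, Complex.re_ofReal_mul, Finset.mul_sum, Finset.sum_mul]
  rw [Finset.sum_comm]
  refine Finset.sum_congr rfl fun s _ => ?_
  have h := sum_ite_eq_off_coordinate (fun j => g j (t j) (s j)) i
    fun a => (N (t i) (a i) (s i) (s i)).re * (P t * Q s * v i t a)
  simp only [Function.update_self] at h
  rw [← h]
  refine Finset.sum_congr rfl fun a _ => ?_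
  split_ifs
  · ring
  · simp
end

section
/- Consider the modified GHZ game with parameter ε, 0 ≤ ε ≤ 1. Let ψ ∈ ℂ^8 (indexed by {0,1}³) be the unit vector with ψ(1,1,1) = 1/2, ψ(0,0,1) = ψ(0,1,0) = ψ(1,0,0) = −1/2 and all other entries 0, and let ρ = ψψ* (the rank-one state with ρ(x,y) = ψ(x)·conj(ψ(y))). For each player take the POVMs: for type 0, M⁰_0 = (1/2)[[1,1],[1,1]] and M⁰_1 = (1/2)[[1,−1],[−1,1]]; for type 1, M¹_0 = [[1,0],[0,0]] and M¹_1 = [[0,0],[0,1]]. Then: (i) each player's expected payoff under this quantum solution equals (1+ε)/2; and (ii) for every player i and every pair of POVMs (X⁰_0,X⁰_1), (X¹_0,X¹_1) on ℂ², the expected payoff of player i when player i measures with X^{t_i} on type t_i while the other two players keep the POVMs M^{t_j} is at most (1+ε)/2. Consequently this quantum solution is a quantum correlated equilibrium of the modified GHZ game. -/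
open Finset ComplexOrder

/-- Prior of the modified GHZ game: probability 1/2 on `(1,1,1)`, probability 1/6 on
each type profile with exactly one `1`, and 0 otherwise. -/
noncomputable def ghzP : (Fin 3 → Fin 2) → ℝ := fun t =>
  if (∑ i, (t i).val) = 3 then 1 / 2
  else if (∑ i, (t i).val) = 1 then 1 / 6
  else 0

/-- Payoffs of the modified GHZ game with parameter `ε`: writing `τ = t₁·t₂·t₃`,
everyone gets 0 if `a₁ ⊕ a₂ ⊕ a₃ ≠ τ`; otherwise player `i` gets `ε` if `a i = τ`
and 1 if `a i ≠ τ`. -/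
noncomputable def ghzV (ε : ℝ) : Fin 3 → (Fin 3 → Fin 2) → (Fin 3 → Fin 2) → ℝ :=
  fun i t a =>
    if (∑ j, (a j).val) % 2 = ∏ j, (t j).val then
      (if (a i).val = ∏ j, (t j).val then ε else 1)
    else 0

/-- The GHZ-type vector `ψ = (|111⟩ - |001⟩ - |010⟩ - |100⟩)/2`. -/
noncomputable def ghzPsi : (Fin 3 → Fin 2) → ℂ := fun x =>
  if (∑ i, (x i).val) = 3 then 1 / 2
  else if (∑ i, (x i).val) = 1 then -(1 / 2)
  else 0

/-- The rank-one state `ρ = ψ ψ*`. -/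
noncomputable def ghzRho : Matrix (Fin 3 → Fin 2) (Fin 3 → Fin 2) ℂ :=
  Matrix.of fun x y => ghzPsi x * (starRingEnd ℂ) (ghzPsi y)

/-- The measurements: on type 0 the POVM `{(1/2)[[1,1],[1,1]], (1/2)[[1,-1],[-1,1]]}`,
on type 1 the POVM `{[[1,0],[0,0]], [[0,0],[0,1]]}` (the same for every player). -/
noncomputable def ghzM : Fin 2 → Fin 2 → Matrix (Fin 2) (Fin 2) ℂ := fun ti ai =>
  if ti = 0 then
    (if ai = 0 then ((1 : ℂ) / 2) • !![1, 1; 1, 1] else ((1 : ℂ) / 2) • !![1, -1; -1, 1])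
  else
    (if ai = 0 then !![1, 0; 0, 0] else !![0, 0; 0, 1])

/-- Expected payoff of player `i` when each player `j` uses the family of
measurements `Meas j` on the state `ghzRho`. -/
noncomputable def ghzPay (ε : ℝ)
    (Meas : Fin 3 → Fin 2 → Fin 2 → Matrix (Fin 2) (Fin 2) ℂ) (i : Fin 3) : ℝ :=
  ∑ t : Fin 3 → Fin 2, ∑ a : Fin 3 → Fin 2,
    ghzP t * ((ghzRho * tensorFam (fun j => Meas j (t j) (a j))).trace).re *
      ghzV ε i t a

theorem sum_fin_three_fin_two {M : Type} [AddCommMonoid M] (F : (Fin 3 → Fin 2) → M) :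
    ∑ f, F f = ∑ i, ∑ j, ∑ k, F ![i, j, k] := by
  rw [← Fintype.sum_prod_type', ← Fintype.sum_prod_type']
  refine (Fintype.sum_bijective (fun p : (Fin 2 × Fin 2) × Fin 2 => ![p.1.1, p.1.2, p.2])
    (by decide) _ _ fun _ => rfl).symm

/-- The trace of `ghzRho` against a product operator, as a sum over the support of `ghzPsi`. -/
theorem trace_ghzRho_mul_tensorFam (K : Fin 3 → Matrix (Fin 2) (Fin 2) ℂ) :
    (ghzRho * tensorFam K).trace = 1 / 4 *
      (K 0 1 1 * K 1 1 1 * K 2 1 1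
        - K 0 1 0 * K 1 1 0 * K 2 1 1 - K 0 1 0 * K 1 1 1 * K 2 1 0 - K 0 1 1 * K 1 1 0 * K 2 1 0
        - K 0 0 1 * K 1 0 1 * K 2 1 1 - K 0 0 1 * K 1 1 1 * K 2 0 1 - K 0 1 1 * K 1 0 1 * K 2 0 1
        + K 0 0 0 * K 1 0 0 * K 2 1 1 + K 0 0 0 * K 1 0 1 * K 2 1 0 + K 0 0 1 * K 1 0 0 * K 2 1 0
        + K 0 0 0 * K 1 1 0 * K 2 0 1 + K 0 0 0 * K 1 1 1 * K 2 0 0 + K 0 0 1 * K 1 1 0 * K 2 0 0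
        + K 0 1 0 * K 1 0 0 * K 2 0 1 + K 0 1 0 * K 1 0 1 * K 2 0 0
        + K 0 1 1 * K 1 0 0 * K 2 0 0) := by
  simp [Matrix.trace, Matrix.mul_apply, sum_fin_three_fin_two, ghzRho, tensorFam, ghzPsi,
    Fin.sum_univ_succ, Fin.prod_univ_succ, map_ofNat]
  ring

set_option maxHeartbeats 1000000 in
/-- The payoff of a unilaterally deviating player is a nonnegative combination of the winning
amplitudes of the deviating measurements. -/
theorem ghzPay_update (ε : ℝ) (i : Fin 3) (X : Fin 2 → Fin 2 → Matrix (Fin 2) (Fin 2) ℂ) :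
    ghzPay ε (Function.update (fun _ => ghzM) i X) i =
      ε / 12 * (X 0 0 0 0 + X 0 0 0 1 + X 0 0 1 0 + X 0 0 1 1).re
      + 1 / 12 * (X 0 1 0 0 - X 0 1 0 1 - X 0 1 1 0 + X 0 1 1 1).re
      + (ε / 12 + 1 / 4) * (X 1 0 0 0).re + (1 / 12 + ε / 4) * (X 1 1 1 1).re := by
  fin_cases i <;>
  · simp [ghzPay, sum_fin_three_fin_two, Fin.sum_univ_succ, Fin.prod_univ_succ, ghzP, ghzV]
    simp only [trace_ghzRho_mul_tensorFam]
    simp [Function.update, ghzM]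
    ring

theorem ghzPay_ghzM (ε : ℝ) (i : Fin 3) : ghzPay ε (fun _ => ghzM) i = (1 + ε) / 2 := by
  have h := ghzPay_update ε i ghzM
  rw [Function.update_eq_self i (fun _ : Fin 3 => ghzM)] at h
  rw [h]
  simp [ghzM]
  ring

theorem posSemidef_fin_two_re_nonneg {A : Matrix (Fin 2) (Fin 2) ℂ} (hA : A.PosSemidef) (c : ℝ) :
    0 ≤ (A 0 0).re + c * (A 0 1).re + c * (A 1 0).re + c ^ 2 * (A 1 1).re := by
  have h := (Complex.le_def.1 (hA.dotProduct_mulVec_nonneg ![1, (c : ℂ)])).1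
  simp [Matrix.mulVec, dotProduct, Fin.sum_univ_succ] at h
  linarith

theorem ghzPay_update_le (ε : ℝ) (hε0 : 0 ≤ ε) (i : Fin 3)
    (X : Fin 2 → Fin 2 → Matrix (Fin 2) (Fin 2) ℂ)
    (hX : ∀ ti : Fin 2, (X ti 0).PosSemidef ∧ (X ti 1).PosSemidef ∧ X ti 0 + X ti 1 = 1) :
    ghzPay ε (Function.update (fun _ => ghzM) i X) i ≤ (1 + ε) / 2 := by
  rw [ghzPay_update]
  obtain ⟨h00, h01, h0⟩ := hX 0
  obtain ⟨h10, h11, h1⟩ := hX 1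
  have entry (t x y : Fin 2) (h : X t 0 + X t 1 = 1) :
      (X t 0 x y).re + (X t 1 x y).re = if x = y then 1 else 0 := by
    have := congrArg (fun A : Matrix (Fin 2) (Fin 2) ℂ => (A x y).re) h
    simp only [Matrix.add_apply, Complex.add_re, Matrix.one_apply] at this
    rw [this]; split_ifs <;> simp
  have e00 := entry 0 0 0 h0
  have e01 := entry 0 0 1 h0
  have e10 := entry 0 1 0 h0
  have e11 := entry 0 1 1 h0
  have f00 := entry 1 0 0 h1
  have f11 := entry 1 1 1 h1
  simp at e00 e01 e10 e11 f00 f11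
  have plus : (X 0 0 0 0 + X 0 0 0 1 + X 0 0 1 0 + X 0 0 1 1).re ≤ 2 := by
    have := posSemidef_fin_two_re_nonneg h01 1
    simp; linarith
  have minus : (X 0 1 0 0 - X 0 1 0 1 - X 0 1 1 0 + X 0 1 1 1).re ≤ 2 := by
    have := posSemidef_fin_two_re_nonneg h00 (-1)
    simp; linarith
  have zero : (X 1 0 0 0).re ≤ 1 := by
    have := (Complex.le_def.1 (h11.diag_nonneg (i := 0))).1
    simp at this; linarith
  have one : (X 1 1 1 1).re ≤ 1 := by
    have := (Complex.le_def.1 (h10.diag_nonneg (i := 1))).1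
    simp at this; linarith
  have hp := mul_le_mul_of_nonneg_left plus hε0
  have hz := mul_le_mul_of_nonneg_left zero hε0
  have ho := mul_le_mul_of_nonneg_left one hε0
  linarith

/-- in the modified GHZ game, the quantum solution `(ghzM, ghzRho)`
gives every player expected payoff `(1+ε)/2`; moreover no player can obtain more
than `(1+ε)/2` by a unilateral change of measurements, so the solution is a quantum
correlated equilibrium. -/
theorem stmt11 (ε : ℝ) (hε0 : 0 ≤ ε) (hε1 : ε ≤ 1) :
    (∀ i : Fin 3, ghzPay ε (fun _ => ghzM) i = (1 + ε) / 2) ∧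
    (∀ (i : Fin 3) (X : Fin 2 → Fin 2 → Matrix (Fin 2) (Fin 2) ℂ),
      (∀ ti : Fin 2, (X ti 0).PosSemidef ∧ (X ti 1).PosSemidef ∧ X ti 0 + X ti 1 = 1) →
      ghzPay ε (Function.update (fun _ => ghzM) i X) i ≤ (1 + ε) / 2) ∧
    (∀ (i : Fin 3) (X : Fin 2 → Fin 2 → Matrix (Fin 2) (Fin 2) ℂ),
      (∀ ti : Fin 2, (X ti 0).PosSemidef ∧ (X ti 1).PosSemidef ∧ X ti 0 + X ti 1 = 1) →
      ghzPay ε (Function.update (fun _ => ghzM) i X) i ≤ ghzPay ε (fun _ => ghzM) i) := by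
  exact ⟨ghzPay_ghzM ε, fun i X hX => ghzPay_update_le ε hε0 i X hX,
    fun i X hX => (ghzPay_update_le ε hε0 i X hX).trans_eq (ghzPay_ghzM ε i).symm⟩
end

section
/- Consider the modified prisoners'-dilemma game with parameter ε ∈ (0,1), and let Q* be the correlation on inputs and outputs {0,1}×{0,1} defined by: Q*(0,0|0,0) = 1; Q*(0,0|0,1) = Q*(0,1|0,1) = 1/2; Q*(0,0|1,0) = Q*(1,0|1,0) = 1/2; Q*(0,1|1,1) = Q*(1,0|1,1) = 1/2; and all other values 0. Then Q* is a canonical communication equilibrium of this game, each player's expected payoff ∑_{t,a} P(t) Q*(a|t) v_i(t,a) equals 1 − ε/2, and the expected social welfare equals 2 − ε. -/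
open Finset

/-- Uniform prior of the modified prisoners'-dilemma game. -/
noncomputable def pdP : (Fin 2 → Fin 2) → ℝ := fun _ => 1 / 4

/-- Payoffs of the modified prisoners'-dilemma game with parameter `ε`: if
`t₁·t₂ = 0` the payoffs are those of a prisoners'-dilemma-like game
((1-ε,1-ε) at (0,0), (2,0) at (0,1), (0,2) at (1,0), (2-ε,2-ε) at (1,1)); if
`t₁·t₂ = 1` the players get 1 each when they anti-coordinate and 0 otherwise. -/
noncomputable def pdV (ε : ℝ) : Fin 2 → (Fin 2 → Fin 2) → (Fin 2 → Fin 2) → ℝ :=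
  fun i t a =>
    if t 0 = 1 ∧ t 1 = 1 then (if a 0 = a 1 then 0 else 1)
    else if a 0 = 0 ∧ a 1 = 0 then 1 - ε
    else if a 0 = 1 ∧ a 1 = 1 then 2 - ε
    else if a i = 0 then 2 else 0

/-- A sum over pairs of bits, written out. -/
lemma sum_fin_two_fun (f : (Fin 2 → Fin 2) → ℝ) :
    ∑ t, f t = f ![0, 0] + f ![0, 1] + f ![1, 0] + f ![1, 1] := by
  rw [← (finTwoArrowEquiv (Fin 2)).symm.sum_comp, Fintype.sum_prod_type]
  simp [Fin.sum_univ_two, add_assoc]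

/-- the correlation `Q*` is a canonical communication equilibrium of
the modified prisoners'-dilemma game, each player's expected payoff is `1 - ε/2`,
and the expected social welfare is `2 - ε`. -/
theorem stmt14 (ε : ℝ) (hε0 : 0 < ε) (hε1 : ε < 1)
    (Q : (Fin 2 → Fin 2) → (Fin 2 → Fin 2) → ℝ)
    (hQ : ∀ t a, Q t a =
      if t 0 = 0 ∧ t 1 = 0 then (if a 0 = 0 ∧ a 1 = 0 then 1 else 0)
      else if t 0 = 0 ∧ t 1 = 1 then (if a 0 = 0 then 1 / 2 else 0)
      else if t 0 = 1 ∧ t 1 = 0 then (if a 1 = 0 then 1 / 2 else 0)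
      else (if a 0 = a 1 then 0 else 1 / 2)) :
    IsCanonCommEq pdP (pdV ε) Q ∧
    (∀ i : Fin 2,
      (∑ t : Fin 2 → Fin 2, ∑ a : Fin 2 → Fin 2, pdP t * Q t a * pdV ε i t a) =
        1 - ε / 2) ∧
    (∑ t : Fin 2 → Fin 2, ∑ a : Fin 2 → Fin 2,
      pdP t * Q t a * (pdV ε 0 t a + pdV ε 1 t a)) = 2 - ε := by
  refine ⟨?_, ?_, ?_⟩
  · intro i ti ri α
    have bit_cases : ∀ x : Fin 2, x = 0 ∨ x = 1 := by decide
    simp only [sum_fin_two_fun, hQ, pdP, pdV]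
    fin_cases i <;> fin_cases ti <;> fin_cases ri <;>
      rcases bit_cases (α 0) with h0 | h0 <;> rcases bit_cases (α 1) with h1 | h1 <;>
      simp [h0, h1] <;> linarith
  · intro i
    simp only [sum_fin_two_fun, hQ, pdP, pdV]
    fin_cases i <;> simp <;> ring
  · simp only [sum_fin_two_fun, hQ, pdP, pdV]
    simp
    ring
end

section
/- Let G be a two-player finite Bayesian game that is constant-sum: there is a function s : T → ℝ with v_1(t,a) + v_2(t,a) = s(t) for all t ∈ T and a ∈ A. Suppose there exist conditional distributions q_1(a_1|t_1) and q_2(a_2|t_2) (with q_i(a_i|t_i) ≥ 0 and ∑_{a_i} q_i(a_i|t_i) = 1) and real numbers w_1, w_2 with w_1 + w_2 = ∑_t P(t) s(t), such that: for every conditional distribution R(a_2|t_1,t_2), ∑_{t,a} P(t) q_1(a_1|t_1) R(a_2|t) v_1(t,a) ≥ w_1; and for every conditional distribution R'(a_1|t_1,t_2), ∑_{t,a} P(t) R'(a_1|t) q_2(a_2|t_2) v_2(t,a) ≥ w_2. Then every canonical communication equilibrium Q of G satisfies ∑_{t,a} P(t) Q(a|t) v_1(t,a) ≤ w_1 and ∑_{t,a}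 P(t) Q(a|t) v_2(t,a) ≤ w_2. -/
open Finset

/-- In a canonical communication equilibrium, a player does not gain by reporting truthfully and
then ignoring the recommendation in favour of a type-dependent mixed action. -/
theorem IsCanonCommEq.sum_mixed_le {ι : Type} [Fintype ι] [DecidableEq ι] {T A : ι → Type}
    [∀ i, Fintype (T i)] [∀ i, Fintype (A i)] [∀ i, DecidableEq (T i)]
    {P : (∀ i, T i) → ℝ} {v : ι → (∀ i, T i) → (∀ i, A i) → ℝ}
    {Q : (∀ i, T i) → (∀ i, A i) → ℝ} (hEq : IsCanonCommEq P v Q) (i : ι)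
    (q : T i → A i → ℝ) (hq0 : ∀ x b, 0 ≤ q x b) (hq1 : ∀ x, ∑ b, q x b = 1) :
    ∑ t, ∑ a, ∑ b, P t * Q t a * (q (t i) b * v i t (Function.update a i b)) ≤
      ∑ t, ∑ a, P t * Q t a * v i t a := by
  have sum_fiber (f : (∀ j, T j) → ℝ) :
      ∑ t, f t = ∑ x : T i, ∑ t : ∀ j, T j, if t i = x then f t else 0 := by
    rw [Finset.sum_comm]
    simp
  have ite_sum (x : T i) (t : ∀ j, T j) (f : (∀ j, A j) → ℝ) :
      (if t i = x then ∑ a, f a else 0) = ∑ a, if t i = x then f a else 0 := by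
    split_ifs <;> simp
  rw [sum_fiber, sum_fiber (fun t => ∑ a, P t * Q t a * v i t a)]
  refine Finset.sum_le_sum fun x _ => ?_
  have h := Finset.sum_le_sum fun b (_ : b ∈ Finset.univ) =>
    mul_le_mul_of_nonneg_left (hEq i x x fun _ => b) (hq0 x b)
  rw [← Finset.sum_mul, hq1, one_mul] at h
  simp only [ite_sum]
  refine le_trans (le_of_eq ?_) h
  simp only [Finset.mul_sum]
  conv_rhs => rw [Finset.sum_comm]
  refine Finset.sum_congr rfl fun t _ => ?_
  conv_rhs => rw [Finset.sum_comm]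
  refine Finset.sum_congr rfl fun a _ => ?_
  split_ifs with hx
  · subst hx
    simp only [Function.update_eq_self]
    exact Finset.sum_congr rfl fun b _ => by ring
  · simp

/-- Replacing one coordinate of a pair amounts to ranging over all pairs that agree with it in the
other coordinate. -/
theorem sum_update_fin_two {A : Fin 2 → Type} [∀ i, Fintype (A i)] [∀ i, DecidableEq (A i)]
    {i j : Fin 2} (hij : i ≠ j) (a : ∀ k, A k) (F : (∀ k, A k) → ℝ) :
    ∑ b, F (Function.update a i b) = ∑ c, if a j = c j then F c else 0 := by
  rw [← Finset.sum_filter]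
  refine Finset.sum_bij' (fun b _ => Function.update a i b) (fun c _ => c i) ?_ ?_ ?_ ?_ ?_
  · simp [Function.update_of_ne hij.symm]
  · simp
  · simp
  · intro c hc
    have hc' : a j = c j := by simpa using hc
    funext k
    obtain rfl | rfl : k = i ∨ k = j := by omega
    · simp
    · simpa [Function.update_of_ne hij.symm] using hc'
  · simp

/-- If player `i` has a mixed strategy guaranteeing `w` against every type-dependent response of
the opponent `j`, then `i` obtains at least `w` in every canonical communication equilibrium. -/
theorem IsCanonCommEq.le_payoff {T A : Fin 2 → Type}
    [∀ i, Fintype (T i)] [∀ i, Fintype (A i)] [∀ i, DecidableEq (T i)]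
    {P : (∀ i, T i) → ℝ} {v : Fin 2 → (∀ i, T i) → (∀ i, A i) → ℝ}
    {Q : (∀ i, T i) → (∀ i, A i) → ℝ} (hEq : IsCanonCommEq P v Q) (hQ : IsCorrelation Q)
    {i j : Fin 2} (hij : i ≠ j)
    (q : T i → A i → ℝ) (hq0 : ∀ x b, 0 ≤ q x b) (hq1 : ∀ x, ∑ b, q x b = 1) {w : ℝ}
    (hmin : ∀ R : (∀ k, T k) → A j → ℝ, (∀ t, (∀ b, 0 ≤ R t b) ∧ ∑ b, R t b = 1) →
      w ≤ ∑ t, ∑ a, P t * q (t i) (a i) * R t (a j) * v i t a) :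
    w ≤ ∑ t, ∑ a, P t * Q t a * v i t a := by
  classical
  refine le_trans (hmin (fun t b => ∑ a, if a j = b then Q t a else 0) fun t => ⟨?_, ?_⟩)
    (le_trans (le_of_eq ?_) (hEq.sum_mixed_le i q hq0 hq1))
  · intro b
    refine Finset.sum_nonneg fun a _ => ?_
    split_ifs
    exacts [hQ.1 t a, le_rfl]
  · rw [Finset.sum_comm]
    simpa using hQ.2 t
  · refine Finset.sum_congr rfl fun t _ => ?_
    have h (a : ∀ k, A k) := sum_update_fin_two hij a
      fun c => P t * Q t a * (q (t i) (c i) * v i t c)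
    simp only [Function.update_self] at h
    simp only [h, Finset.mul_sum, Finset.sum_mul]
    rw [Finset.sum_comm]
    refine Finset.sum_congr rfl fun a _ => Finset.sum_congr rfl fun c _ => ?_
    split_ifs <;> ring

/-- in a two-player constant-sum Bayesian game, if each player `i` has
a mixed strategy `qᵢ` guaranteeing him `wᵢ` against any (type-dependent) response of
the opponent, with `w₁ + w₂ = ⟨s⟩`, then in every canonical communication equilibrium
player `i`'s expected payoff is at most `wᵢ`. -/
theorem stmt16 {T A : Fin 2 → Type}
    [∀ i, Fintype (T i)] [∀ i, Nonempty (T i)] [∀ i, DecidableEq (T i)]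
    [∀ i, Fintype (A i)] [∀ i, Nonempty (A i)]
    (P : (∀ i, T i) → ℝ) (v : Fin 2 → (∀ i, T i) → (∀ i, A i) → ℝ)
    (hP0 : ∀ t, 0 ≤ P t) (hP1 : ∑ t : ∀ i, T i, P t = 1)
    (sfun : (∀ i, T i) → ℝ)
    (hconst : ∀ t a, v 0 t a + v 1 t a = sfun t)
    (q₁ : T 0 → A 0 → ℝ) (q₂ : T 1 → A 1 → ℝ)
    (hq₁0 : ∀ t₁ a₁, 0 ≤ q₁ t₁ a₁) (hq₁1 : ∀ t₁, ∑ a₁ : A 0, q₁ t₁ a₁ = 1)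
    (hq₂0 : ∀ t₂ a₂, 0 ≤ q₂ t₂ a₂) (hq₂1 : ∀ t₂, ∑ a₂ : A 1, q₂ t₂ a₂ = 1)
    (w₁ w₂ : ℝ)
    (hw : w₁ + w₂ = ∑ t : ∀ i, T i, P t * sfun t)
    (hmin₁ : ∀ R : (∀ i, T i) → A 1 → ℝ,
      (∀ t, (∀ a₂, 0 ≤ R t a₂) ∧ ∑ a₂ : A 1, R t a₂ = 1) →
      (∑ t : ∀ i, T i, ∑ a : ∀ i, A i,
        P t * q₁ (t 0) (a 0) * R t (a 1) * v 0 t a) ≥ w₁)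
    (hmin₂ : ∀ R' : (∀ i, T i) → A 0 → ℝ,
      (∀ t, (∀ a₁, 0 ≤ R' t a₁) ∧ ∑ a₁ : A 0, R' t a₁ = 1) →
      (∑ t : ∀ i, T i, ∑ a : ∀ i, A i,
        P t * R' t (a 0) * q₂ (t 1) (a 1) * v 1 t a) ≥ w₂)
    (Q : (∀ i, T i) → (∀ i, A i) → ℝ)
    (hQ : IsCorrelation Q)
    (hEq : IsCanonCommEq P v Q) :
    (∑ t : ∀ i, T i, ∑ a : ∀ i, A i, P t * Q t a * v 0 t a) ≤ w₁ ∧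
    (∑ t : ∀ i, T i, ∑ a : ∀ i, A i, P t * Q t a * v 1 t a) ≤ w₂ := by
  have h₁ := hEq.le_payoff hQ (i := 0) (j := 1) (by decide) q₁ hq₁0 hq₁1 hmin₁
  have h₂ := hEq.le_payoff hQ (i := 1) (j := 0) (by decide) q₂ hq₂0 hq₂1 (w := w₂) fun R hR =>
    (hmin₂ R hR).trans_eq <| by simp only [mul_right_comm]
  have hsum : (∑ t, ∑ a, P t * Q t a * v 0 t a) + ∑ t, ∑ a, P t * Q t a * v 1 t a =
      ∑ t, P t * sfun t := by
    simp only [← Finset.sum_add_distrib, ← mul_add, hconst]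
    simp only [← Finset.sum_mul, ← Finset.mul_sum, hQ.2, mul_one]
  constructor <;> linarith
end

section
/- For every local correlation Q with inputs {0,1}×{0,1} and outputs {0,1}×{0,1}, the winning probability in the CHSH game is at most 3/4: (1/4) · ∑_{t_1,t_2,a_1,a_2 ∈ {0,1}} Q(a_1,a_2 | t_1,t_2) · [a_1 XOR a_2 = t_1 AND t_2] ≤ 3/4, where [x] is 1 if the condition x holds and 0 otherwise. Equivalently, no local correlation achieves expected payoff greater than 3/4 in the CHSH game. -/
open Finset

/-- A correlation is local if it can be produced from shared randomness `V` on a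
finite set together with local conditional distributions `L i`. -/
def IsLocal {ι : Type} [Fintype ι] [DecidableEq ι] {R S : ι → Type}
    [∀ i, Fintype (S i)]
    (Q : (∀ i, R i) → (∀ i, S i) → ℝ) : Prop :=
  ∃ (m : ι → ℕ) (V : (∀ i, Fin (m i)) → ℝ) (L : ∀ i, R i → Fin (m i) → S i → ℝ),
    (∀ i, 0 < m i) ∧
    (∀ γ, 0 ≤ V γ) ∧ (∑ γ : ∀ i, Fin (m i), V γ = 1) ∧
    (∀ i r γi, (∀ si, 0 ≤ L i r γi si) ∧ ∑ si : S i, L i r γi si = 1) ∧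
    ∀ r s, Q r s = ∑ γ : ∀ i, Fin (m i), V γ * ∏ i, L i (r i) (γ i) (s i)

/-- Summing over pairs of booleans, indexed by `Fin 2`. -/
theorem sum_fin_two_bool (f : (Fin 2 → Bool) → ℝ) :
    ∑ t, f t = f ![true, true] + f ![true, false] + f ![false, true] + f ![false, false] := by
  rw [← (finTwoArrowEquiv Bool).symm.sum_comp]
  simp [Fintype.sum_prod_type, finTwoArrowEquiv, add_assoc]

/-- The CHSH inequality for independent outputs, where `x₀`, `x₁`, `y₀`, `y₁` are the
probabilities of one of the two outputs. -/
theorem chsh_inequality {x₀ x₁ y₀ y₁ : ℝ} (hx₀ : 0 ≤ x₀) (hx₀' : x₀ ≤ 1) (hx₁ : 0 ≤ x₁)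
    (hx₁' : x₁ ≤ 1) (hy₀ : 0 ≤ y₀) (hy₀' : y₀ ≤ 1) (hy₁ : 0 ≤ y₁) (hy₁' : y₁ ≤ 1) :
    x₀ * y₀ + x₀ * y₁ + x₁ * y₀ - x₁ * y₁ ≤ x₀ + y₀ := by
  rw [← sub_nonneg] at hx₀' hx₁' hy₀' hy₁'
  have key : x₀ + y₀ - (x₀ * y₀ + x₀ * y₁ + x₁ * y₀ - x₁ * y₁) =
      (1 - x₀) * (1 - x₁) * y₀ + x₀ * (1 - x₁) * (1 - y₁) + (1 - x₀) * x₁ * y₁ +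
        x₀ * x₁ * (1 - y₀) := by ring
  rw [← sub_nonneg, key]
  positivity

/-- Players who randomize independently win the CHSH game for a total weight of at most `3`
over the four input pairs. -/
theorem chsh_product_le (p : Fin 2 → Bool → Bool → ℝ) (hp : ∀ i r s, 0 ≤ p i r s)
    (hp' : ∀ i r, ∑ s, p i r s = 1) :
    ∑ t : Fin 2 → Bool, ∑ a : Fin 2 → Bool,
      (∏ i, p i (t i) (a i)) * (if Bool.xor (a 0) (a 1) = (t 0 && t 1) then 1 else 0) ≤ 3 := by
  have hfalse (i r) : p i r false = 1 - p i r true := by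
    have := hp' i r
    rw [Fintype.sum_bool] at this
    linarith
  have hle (i r) : p i r true ≤ 1 := by
    have := hp i r false
    rw [hfalse] at this
    linarith
  have key := chsh_inequality (hp 0 false true) (hle 0 false) (hp 0 true true) (hle 0 true)
    (hp 1 false true) (hle 1 false) (hp 1 true true) (hle 1 true)
  simp [sum_fin_two_bool, Fin.prod_univ_two, hfalse]
  linarith

/-- no local correlation wins the CHSH game with probability greater
than 3/4. -/
theorem stmt17 (Q : (Fin 2 → Bool) → (Fin 2 → Bool) → ℝ)
    (hQ : IsCorrelation Q) (hloc : IsLocal Q) :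
    (1 / 4 : ℝ) * ∑ t : Fin 2 → Bool, ∑ a : Fin 2 → Bool,
      Q t a * (if Bool.xor (a 0) (a 1) = (t 0 && t 1) then 1 else 0) ≤ 3 / 4 := by
  obtain ⟨m, V, L, -, hV, hV', hL, hQL⟩ := hloc
  have key : ∑ t : Fin 2 → Bool, ∑ a : Fin 2 → Bool,
      Q t a * (if Bool.xor (a 0) (a 1) = (t 0 && t 1) then 1 else 0) =
      ∑ γ, V γ * ∑ t : Fin 2 → Bool, ∑ a : Fin 2 → Bool, (∏ i, L i (t i) (γ i) (a i)) *
        (if Bool.xor (a 0) (a 1) = (t 0 && t 1) then 1 else 0) := by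
    simp_rw [hQL, Finset.sum_mul, Finset.mul_sum, mul_assoc]
    rw [Finset.sum_comm (s := (Finset.univ : Finset (∀ i, Fin (m i))))]
    exact Finset.sum_congr rfl fun t _ => Finset.sum_comm
  have hle : ∑ γ, V γ * ∑ t : Fin 2 → Bool, ∑ a : Fin 2 → Bool, (∏ i, L i (t i) (γ i) (a i)) *
        (if Bool.xor (a 0) (a 1) = (t 0 && t 1) then 1 else 0) ≤ ∑ γ, V γ * 3 :=
    Finset.sum_le_sum fun γ _ => mul_le_mul_of_nonneg_left
      (chsh_product_le (fun i r s => L i r (γ i) s) (fun i r s => (hL i r (γ i)).1 s)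
        (fun i r => (hL i r (γ i)).2)) (hV γ)
  rw [← Finset.sum_mul, hV'] at hle
  rw [key]
  linarith
end

section
/- Let Q be the PR-box correlation, Q(a_1,a_2 | t_1,t_2) = 1/2 if a_1 XOR a_2 = t_1 AND t_2 and 0 otherwise. Then: (i) Q is belief-invariant; (ii) Q is not local; (iii) Q is a canonical communication equilibrium of the CHSH game, under which each player's expected payoff ∑_{t,a} P(t) Q(a|t) v_i(t,a) equals 1 (the maximum possible payoff). -/
open Finset

/-- Uniform prior of the CHSH game. -/
noncomputable def chshP : (Fin 2 → Bool) → ℝ := fun _ => 1 / 4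

/-- Common payoff of the CHSH game: win iff `a₁ ⊕ a₂ = t₁ ∧ t₂`. -/
noncomputable def chshV : Fin 2 → (Fin 2 → Bool) → (Fin 2 → Bool) → ℝ :=
  fun _ t a => if Bool.xor (a 0) (a 1) = (t 0 && t 1) then 1 else 0

/-- The PR box. -/
noncomputable def prBox : (Fin 2 → Bool) → (Fin 2 → Bool) → ℝ :=
  fun t a => if Bool.xor (a 0) (a 1) = (t 0 && t 1) then 1 / 2 else 0

/-- Summation over pairs of bits, written out. -/
theorem sum_bool_pair (f : (Fin 2 → Bool) → ℝ) :
    ∑ a : Fin 2 → Bool, f a =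
      f ![true, true] + f ![true, false] + (f ![false, true] + f ![false, false]) := by
  rw [← (finTwoArrowEquiv Bool).symm.sum_comp, Fintype.sum_prod_type]
  simp [finTwoArrowEquiv]

theorem isCorrelation_prBox : IsCorrelation prBox := by
  refine ⟨fun r s => ?_, fun r => ?_⟩
  · unfold prBox
    split_ifs <;> norm_num
  · rw [sum_bool_pair]
    cases h₀ : r 0 <;> cases h₁ : r 1 <;> norm_num [prBox, h₀, h₁]

theorem isBeliefInvariant_prBox : IsBeliefInvariant prBox := by
  intro I r r' h s₀
  rw [sum_bool_pair, sum_bool_pair]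
  by_cases h0 : (0 : Fin 2) ∈ I <;> by_cases h1 : (1 : Fin 2) ∈ I
  · have hr : r = r' := by
      funext i
      fin_cases i
      · exact h 0 h0
      · exact h 1 h1
    rw [hr]
  all_goals
    simp only [prBox, Fin.forall_fin_two, h0, h1, true_imp_iff, false_imp_iff, and_true, true_and,
      Matrix.cons_val_zero, Matrix.cons_val_one]
    generalize (r 0 && r 1) = x
    generalize (r' 0 && r' 1) = y
    generalize s₀ 0 = u
    generalize s₀ 1 = w
    cases x <;> cases y <;> cases u <;> cases w <;> norm_num

/-- No pair of deterministic local strategies wins the CHSH game on all inputs. -/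
theorem not_forall_xor_eq_and (f g : Bool → Bool) :
    ¬ ∀ x y, Bool.xor (f x) (g y) = (x && y) := by
  intro h
  have h₁ := h false false
  have h₂ := h false true
  have h₃ := h true false
  have h₄ := h true true
  revert h₁ h₂ h₃ h₄
  generalize f false = a
  generalize f true = b
  generalize g false = c
  generalize g true = d
  revert a b c d
  decide

theorem not_isLocal_prBox : ¬ IsLocal prBox := by
  rintro ⟨m, V, L, -, hV, hV1, hL, hQ⟩
  obtain ⟨γ, -, hγ⟩ : ∃ γ ∈ univ, 0 < V γ :=
    exists_lt_of_sum_lt (by simp [hV1])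
  have hpos : ∀ i r, ∃ s, 0 < L i r (γ i) s := by
    intro i r
    obtain ⟨s, -, hs⟩ : ∃ s ∈ univ, 0 < L i r (γ i) s :=
      exists_lt_of_sum_lt (by simp only [sum_const_zero, (hL i r (γ i)).2, zero_lt_one])
    exact ⟨s, hs⟩
  choose a ha using hpos
  refine not_forall_xor_eq_and (a 0) (a 1) fun x y => ?_
  have hprod : ∀ (r s : Fin 2 → Bool) (δ : ∀ i, Fin (m i)),
      0 ≤ V δ * ∏ i, L i (r i) (δ i) (s i) := fun r s δ =>
    mul_nonneg (hV δ) (prod_nonneg fun i _ => (hL i (r i) (δ i)).1 (s i))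
  have hbox : 0 < prBox ![x, y] fun i => a i (![x, y] i) := by
    rw [hQ]
    exact sum_pos' (fun δ _ => hprod _ _ δ)
      ⟨γ, mem_univ γ, mul_pos hγ (prod_pos fun i _ => ha i _)⟩
  by_contra hne
  simp [prBox, hne] at hbox

theorem prBox_mul_chshV (i : Fin 2) (t a : Fin 2 → Bool) :
    prBox t a * chshV i t a = prBox t a := by
  unfold prBox chshV
  split_ifs <;> simp

theorem chshV_le_one (i : Fin 2) (t a : Fin 2 → Bool) : chshV i t a ≤ 1 := by
  unfold chshV
  split_ifs <;> norm_num

theorem isCanonCommEq_prBox : IsCanonCommEq chshP chshV prBox := by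
  intro i ti ri α
  refine sum_le_sum fun t _ => ?_
  by_cases ht : t i = ti
  · simp only [if_pos ht, mul_assoc, prBox_mul_chshV, ← mul_sum]
    refine mul_le_mul_of_nonneg_left ?_ (by norm_num [chshP])
    rw [isCorrelation_prBox.2, ← isCorrelation_prBox.2 (Function.update t i ri)]
    exact sum_le_sum fun a _ =>
      mul_le_of_le_one_right (isCorrelation_prBox.1 _ _) (chshV_le_one _ _ _)
  · simp [ht]

/-- the PR box is belief-invariant, is not local, and is a canonical
communication equilibrium of the CHSH game in which each player's expected payoff is
1 (the maximum possible). -/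
theorem stmt18 :
    IsBeliefInvariant prBox ∧
    ¬ IsLocal prBox ∧
    IsCanonCommEq chshP chshV prBox ∧
    ∀ i : Fin 2,
      (∑ t : Fin 2 → Bool, ∑ a : Fin 2 → Bool, chshP t * prBox t a * chshV i t a) = 1 := by
  refine ⟨isBeliefInvariant_prBox, not_isLocal_prBox, isCanonCommEq_prBox, fun i => ?_⟩
  simp only [mul_assoc, prBox_mul_chshV, ← mul_sum, isCorrelation_prBox.2]
  norm_num [chshP]
end

section
/- Consider the modified GHZ game with parameter ε ∈ (0,1). Define the correlation Q with inputs T = {0,1}³ and outputs A = {0,1}³ by: Q(a|t) = 1/4 if a_1 XOR a_2 XOR a_3 = t_1·t_2·t_3, and Q(a|t) = 0 otherwise (this agrees with the uniform distributions on the corresponding four-element sets of action profiles). Then: (i) Q is belief-invariant; (ii) Q is a canonical communication equilibrium of the modified GHZ game; (iii) each player's expected payoff ∑_{t,a} P(t) Q(a|t) v_i(t,a) equals (1+ε)/2. -/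
open Finset

/-- The belief-invariant correlation for the modified GHZ game: the uniform
distribution on the four action profiles with `a₁ ⊕ a₂ ⊕ a₃ = t₁·t₂·t₃`. -/
noncomputable def ghzQ : (Fin 3 → Fin 2) → (Fin 3 → Fin 2) → ℝ :=
  fun t a => if (∑ j, (a j).val) % 2 = ∏ j, (t j).val then 1 / 4 else 0

/-- A sum over the profiles of three binary coordinates, written out. -/
lemma sum_fin_three_fin_two_s19 (f : (Fin 3 → Fin 2) → ℝ) :
    ∑ t, f t = f ![0, 0, 0] + f ![0, 0, 1] + f ![0, 1, 0] + f ![0, 1, 1] +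
      f ![1, 0, 0] + f ![1, 0, 1] + f ![1, 1, 0] + f ![1, 1, 1] := by
  have h : (univ : Finset (Fin 3 → Fin 2)) = {![0, 0, 0], ![0, 0, 1], ![0, 1, 0], ![0, 1, 1],
      ![1, 0, 0], ![1, 0, 1], ![1, 1, 0], ![1, 1, 1]} := by decide
  rw [h]
  repeat rw [sum_insert (by decide)]
  rw [sum_singleton]
  ring

/-- The expectation under the prior `ghzP`, written out. -/
lemma sum_ghzP_mul (f : (Fin 3 → Fin 2) → ℝ) :
    ∑ t, ghzP t * f t =
      1 / 6 * (f ![0, 0, 1] + f ![0, 1, 0] + f ![1, 0, 0]) + 1 / 2 * f ![1, 1, 1] := by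
  rw [sum_fin_three_fin_two_s19]
  simp [ghzP, Fin.sum_univ_three]
  ring

lemma involutive_update_one_sub (j : Fin 3) :
    Function.Involutive fun s : Fin 3 → Fin 2 => Function.update s j (1 - s j) := by
  intro s
  simp

/-- Flipping one output of `ghzQ` is the same as flipping the product of the inputs. -/
lemma ghzQ_update_one_sub {r r' : Fin 3 → Fin 2}
    (h : ∏ i, (r i).val ≠ ∏ i, (r' i).val) (s : Fin 3 → Fin 2) (j : Fin 3) :
    ghzQ r' (Function.update s j (1 - s j)) = ghzQ r s := by
  have key : ∀ r r' : Fin 3 → Fin 2, ∏ i, (r i).val ≠ ∏ i, (r' i).val → ∀ p < 2,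
      (p = ∏ i, (r i).val ↔ 1 - p = ∏ i, (r' i).val) := by decide
  have flip : ∀ (s : Fin 3 → Fin 2) (j : Fin 3),
      (∑ i, (Function.update s j (1 - s j) i).val) % 2 = 1 - (∑ i, (s i).val) % 2 := by decide
  simp only [ghzQ, flip, key r r' h _ (Nat.mod_lt _ two_pos)]

lemma isBeliefInvariant_ghzQ : IsBeliefInvariant ghzQ := by
  intro I r r' hr s₀
  by_cases h : ∏ i, (r i).val = ∏ i, (r' i).val
  · simp only [ghzQ, h]
  · obtain ⟨j, hj⟩ : ∃ j, j ∉ I := by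
      by_contra! hI
      exact h (prod_congr rfl fun i _ => by rw [hr i (hI i)])
    refine Fintype.sum_equiv (involutive_update_one_sub j).toPerm _ _ fun s => ?_
    have hs : (∀ i ∈ I, Function.update s j (1 - s j) i = s₀ i) ↔ ∀ i ∈ I, s i = s₀ i :=
      forall₂_congr fun i hi => by
        rw [Function.update_of_ne (ne_of_mem_of_not_mem hi hj)]
    simp only [Function.Involutive.coe_toPerm, hs, ghzQ_update_one_sub h]
    congr

lemma prod_val_eq_zero_or_one (t : Fin 3 → Fin 2) :
    ∏ j, (t j).val = 0 ∨ ∏ j, (t j).val = 1 := by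
  revert t
  decide

/-- The payoff to player `i` when the types are `t`, the reports are `t'`, and the
recommendation is answered by `α`. Given a recommendation `b`, the others' actions have
parity `b + ∏ t'`, so the answer wins exactly if `α b + b` has the parity of `∏ t + ∏ t'`. -/
lemma sum_ghzQ_mul_ghzV_update (ε : ℝ) (i : Fin 3) (t t' : Fin 3 → Fin 2)
    (α : Fin 2 → Fin 2) :
    ∑ a, ghzQ t' a * ghzV ε i t (Function.update a i (α (a i))) =
      1 / 2 * ∑ b, if ((α b).val + b.val) % 2 = (∏ j, (t j).val + ∏ j, (t' j).val) % 2 then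
        (if (α b).val = ∏ j, (t j).val then ε else 1) else 0 := by
  rw [sum_fin_three_fin_two_s19]
  obtain ⟨x, hx⟩ : ∃ x, α 0 = x := ⟨_, rfl⟩
  obtain ⟨y, hy⟩ : ∃ y, α 1 = y := ⟨_, rfl⟩
  rcases prod_val_eq_zero_or_one t with ht | ht <;>
  rcases prod_val_eq_zero_or_one t' with ht' | ht' <;>
  simp only [ghzQ, ghzV, ht, ht', Fin.sum_univ_three, Fin.sum_univ_two] <;>
  fin_cases i <;> fin_cases x <;> fin_cases y <;>
  simp [hx, hy] <;> ring

lemma sum_ghzQ_mul_ghzV (ε : ℝ) (i : Fin 3) (t : Fin 3 → Fin 2) :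
    ∑ a, ghzQ t a * ghzV ε i t a = (1 + ε) / 2 := by
  have h := sum_ghzQ_mul_ghzV_update ε i t t id
  simp only [id, Function.update_eq_self] at h
  rw [h]
  rcases prod_val_eq_zero_or_one t with ht | ht <;> simp [ht] <;> ring

lemma isCanonCommEq_ghzQ {ε : ℝ} (hε0 : 0 < ε) (hε1 : ε < 1) :
    IsCanonCommEq ghzP (ghzV ε) ghzQ := by
  intro i ti ri α
  have honest : (∑ t : Fin 3 → Fin 2, ∑ a : Fin 3 → Fin 2,
      if t i = ti then ghzP t * ghzQ t a * ghzV ε i t a else 0) =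
      ∑ t, ghzP t * if t i = ti then (1 + ε) / 2 else 0 := by
    refine sum_congr rfl fun t _ => ?_
    split_ifs
    · simp only [mul_assoc, ← mul_sum, sum_ghzQ_mul_ghzV]
    · simp
  have deviation : (∑ t : Fin 3 → Fin 2, ∑ a : Fin 3 → Fin 2, if t i = ti then
      ghzP t * ghzQ (Function.update t i ri) a *
        ghzV ε i t (Function.update a i (α (a i))) else 0) =
      ∑ t, ghzP t * if t i = ti then
        ∑ a, ghzQ (Function.update t i ri) a * ghzV ε i t (Function.update a i (α (a i)))
        else 0 := by
    refine sum_congr rfl fun t _ => ?_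
    split_ifs
    · simp only [mul_assoc, ← mul_sum]
    · simp
  rw [honest, deviation, sum_ghzP_mul, sum_ghzP_mul]
  simp only [sum_ghzQ_mul_ghzV_update, Fin.sum_univ_two, Fin.prod_univ_three]
  obtain ⟨x, hx⟩ : ∃ x, α 0 = x := ⟨_, rfl⟩
  obtain ⟨y, hy⟩ : ∃ y, α 1 = y := ⟨_, rfl⟩
  fin_cases i <;> fin_cases ti <;> fin_cases ri <;> fin_cases x <;> fin_cases y <;>
    simp [hx, hy] <;>
    linarith

/-- the correlation `ghzQ` is belief-invariant, is a canonical
communication equilibrium of the modified GHZ game, and gives each player expected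
payoff `(1+ε)/2`. -/
theorem stmt19 (ε : ℝ) (hε0 : 0 < ε) (hε1 : ε < 1) :
    IsBeliefInvariant ghzQ ∧
    IsCanonCommEq ghzP (ghzV ε) ghzQ ∧
    ∀ i : Fin 3,
      (∑ t : Fin 3 → Fin 2, ∑ a : Fin 3 → Fin 2,
        ghzP t * ghzQ t a * ghzV ε i t a) = (1 + ε) / 2 := by
  refine ⟨isBeliefInvariant_ghzQ, isCanonCommEq_ghzQ hε0 hε1, fun i => ?_⟩
  simp only [mul_assoc, ← mul_sum, sum_ghzQ_mul_ghzV]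
  rw [sum_ghzP_mul]
  ring
end
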